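/- Let (A, Q) be a relative n-Auslander–Gorenstein pair with pd_A Q ≤ d, id_A Q ≤ n − d, Ext^{i>0}_A(Q,Q) = 0, and 2 ≤ d. Let Λ = End_A(Q)^op. Then add(Ω^d(Q) ⊕ Λ) = add(ν⁻_Λ Ω^{−(n−d)}(Q) ⊕ Λ) as subcategories of right Λ-modules, where ν⁻_Λ = Hom_Λ(D(−), Λ) is the inverse Nakayama functor. -/

import Mathlib

universe u
open MulOpposite

noncomputable section
namespace Paper

section RingDefs
variable (B : Type u) [Ring B]

/-- `X` belongs to `add Q`: it is a direct summand of a finite direct sum of copies of `Q`. -/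
def InAdd (Q X : ModuleCat.{u} B) : Prop :=
  ∃ (n : ℕ) (s : X →ₗ[B] (Fin n → Q)) (r : (Fin n → Q) →ₗ[B] X), r ∘ₗ s = LinearMap.id

/-- A superfluous (small) submodule. -/
def Superfluous {P : ModuleCat.{u} B} (N : Submodule B P) : Prop :=
  ∀ K : Submodule B P, K ⊔ N = ⊤ → K = ⊤

/-- An essential (large) submodule. -/
def Essential {P : ModuleCat.{u} B} (N : Submodule B P) : Prop :=
  ∀ K : Submodule B P, K ⊓ N = ⊥ → K = ⊥

/-- `p : P → X` is a projective cover. -/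
def IsProjCover {P X : ModuleCat.{u} B} (p : P →ₗ[B] X) : Prop :=
  Module.Projective B P ∧ Function.Surjective p ∧ Superfluous B (LinearMap.ker p)

/-- `ι : X → I` is an injective envelope. -/
def IsInjEnvelope {X I : ModuleCat.{u} B} (ι : X →ₗ[B] I) : Prop :=
  Module.Injective B I ∧ Function.Injective ι ∧ Essential B (LinearMap.range ι)

/-- The zero module. -/
def zeroMod : ModuleCat.{u} B := ModuleCat.of B PUnit

/-- An exact sequence `0 → P_m → ⋯ → P_1 → P_0 → X → 0` whose terms satisfy the
predicate `T` and which remains exact under `Hom(test, −)`. -/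
def ResLE (test : ModuleCat.{u} B) (T : ModuleCat.{u} B → Prop)
    (X : ModuleCat.{u} B) (m : ℕ) : Prop :=
  ∃ (P : ℕ → ModuleCat.{u} B) (d : ∀ j, P (j+1) →ₗ[B] P j) (aug : P 0 →ₗ[B] X),
    (∀ j, j ≤ m → T (P j)) ∧ (∀ j, m < j → Subsingleton (P j)) ∧
    Function.Surjective aug ∧ Function.Exact (d 0) aug ∧
    (∀ j, Function.Exact (d (j+1)) (d j)) ∧
    (∀ f : test →ₗ[B] X, ∃ h : test →ₗ[B] P 0, aug ∘ₗ h = f) ∧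
    (∀ f : test →ₗ[B] P 0, aug ∘ₗ f = 0 → ∃ h : test →ₗ[B] P 1, d 0 ∘ₗ h = f) ∧
    (∀ j, ∀ f : test →ₗ[B] P (j+1), d j ∘ₗ f = 0 →
      ∃ h : test →ₗ[B] P (j+2), d (j+1) ∘ₗ h = f)

/-- An exact sequence `0 → X → I_0 → ⋯ → I_m → 0` whose terms satisfy the predicate `T`
and which remains exact under `Hom(−, test)`. -/
def CoresLE (test : ModuleCat.{u} B) (T : ModuleCat.{u} B → Prop)
    (X : ModuleCat.{u} B) (m : ℕ) : Prop :=
  ∃ (M : ℕ → ModuleCat.{u} B) (ι : X →ₗ[B] M 0) (d : ∀ j, M j →ₗ[B] M (j+1)),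
    (∀ j, j ≤ m → T (M j)) ∧ (∀ j, m < j → Subsingleton (M j)) ∧
    Function.Injective ι ∧ Function.Exact ι (d 0) ∧
    (∀ j, Function.Exact (d j) (d (j+1))) ∧
    (∀ f : X →ₗ[B] test, ∃ h : M 0 →ₗ[B] test, h ∘ₗ ι = f) ∧
    (∀ f : M 0 →ₗ[B] test, f ∘ₗ ι = 0 → ∃ h : M 1 →ₗ[B] test, h ∘ₗ d 0 = f) ∧
    (∀ j, ∀ f : M (j+1) →ₗ[B] test, f ∘ₗ d j = 0 →
      ∃ h : M (j+2) →ₗ[B] test, h ∘ₗ d (j+1) = f)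

/-- Projective dimension at most `n`. -/
def pdLE (X : ModuleCat.{u} B) (n : ℕ) : Prop :=
  ResLE B (zeroMod B) (fun P => Module.Projective B P) X n

/-- Injective dimension at most `n`. -/
def idLE (X : ModuleCat.{u} B) (n : ℕ) : Prop :=
  CoresLE B (zeroMod B) (fun I => Module.Injective B I) X n

/-- Projective dimension equal to `n`. -/
def pdEq (X : ModuleCat.{u} B) (n : ℕ) : Prop :=
  pdLE B X n ∧ ∀ j, pdLE B X j → n ≤ j

/-- Injective dimension equal to `n`. -/
def idEq (X : ModuleCat.{u} B) (n : ℕ) : Prop :=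
  idLE B X n ∧ ∀ j, idLE B X j → n ≤ j

/-- Projective dimension as an element of `ℕ∞`. -/
def pdDim (X : ModuleCat.{u} B) : ℕ∞ :=
  sInf {c : ℕ∞ | ∃ n : ℕ, c = n ∧ pdLE B X n}

/-- Injective dimension as an element of `ℕ∞`. -/
def idDim (X : ModuleCat.{u} B) : ℕ∞ :=
  sInf {c : ℕ∞ | ∃ n : ℕ, c = n ∧ idLE B X n}

/-- Relative dominant dimension of `X` with respect to `Q` is at least `n`:
there is an exact sequence `0 → X → Q_1 → ⋯ → Q_n` with `Q_i ∈ add Q`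
remaining exact under `Hom(−, Q)`. -/
def domdimGE (Q X : ModuleCat.{u} B) (n : ℕ) : Prop :=
  n = 0 ∨ ∃ (M : ℕ → ModuleCat.{u} B) (ι : X →ₗ[B] M 0) (d : ∀ j, M j →ₗ[B] M (j+1)),
    (∀ j, j + 1 ≤ n → InAdd B Q (M j)) ∧
    Function.Injective ι ∧ (2 ≤ n → Function.Exact ι (d 0)) ∧
    (∀ j, j + 3 ≤ n → Function.Exact (d j) (d (j+1))) ∧
    (∀ f : X →ₗ[B] Q, ∃ h : M 0 →ₗ[B] Q, h ∘ₗ ι = f) ∧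
    (2 ≤ n → ∀ f : M 0 →ₗ[B] Q, f ∘ₗ ι = 0 → ∃ h : M 1 →ₗ[B] Q, h ∘ₗ d 0 = f) ∧
    (∀ j, j + 3 ≤ n → ∀ f : M (j+1) →ₗ[B] Q, f ∘ₗ d j = 0 →
      ∃ h : M (j+2) →ₗ[B] Q, h ∘ₗ d (j+1) = f)

/-- Relative codominant dimension of `X` with respect to `Q` is at least `n`. -/
def codomdimGE (Q X : ModuleCat.{u} B) (n : ℕ) : Prop :=
  n = 0 ∨ ∃ (M : ℕ → ModuleCat.{u} B) (aug : M 0 →ₗ[B] X) (d : ∀ j, M (j+1) →ₗ[B] M j),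
    (∀ j, j + 1 ≤ n → InAdd B Q (M j)) ∧
    Function.Surjective aug ∧ (2 ≤ n → Function.Exact (d 0) aug) ∧
    (∀ j, j + 3 ≤ n → Function.Exact (d (j+1)) (d j)) ∧
    (∀ f : Q →ₗ[B] X, ∃ h : Q →ₗ[B] M 0, aug ∘ₗ h = f) ∧
    (2 ≤ n → ∀ f : Q →ₗ[B] M 0, aug ∘ₗ f = 0 → ∃ h : Q →ₗ[B] M 1, d 0 ∘ₗ h = f) ∧
    (∀ j, j + 3 ≤ n → ∀ f : Q →ₗ[B] M (j+1), d j ∘ₗ f = 0 →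
      ∃ h : Q →ₗ[B] M (j+2), d (j+1) ∘ₗ h = f)

/-- Relative dominant dimension with respect to `Q`, as an element of `ℕ∞`. -/
def relDomDim (Q X : ModuleCat.{u} B) : ℕ∞ :=
  sSup {c : ℕ∞ | ∃ n : ℕ, c = n ∧ domdimGE B Q X n}

/-- Relative codominant dimension with respect to `Q`, as an element of `ℕ∞`. -/
def relCodomDim (Q X : ModuleCat.{u} B) : ℕ∞ :=
  sSup {c : ℕ∞ | ∃ n : ℕ, c = n ∧ codomdimGE B Q X n}

/-- A projective resolution. -/
structure ProjRes (X : ModuleCat.{u} B) where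
  P : ℕ → ModuleCat.{u} B
  d : ∀ j, P (j+1) →ₗ[B] P j
  aug : P 0 →ₗ[B] X
  proj : ∀ j, Module.Projective B (P j)
  augSurj : Function.Surjective aug
  exact0 : Function.Exact (d 0) aug
  exact : ∀ j, Function.Exact (d (j+1)) (d j)

/-- Vanishing of `Ext^i(X, Y)`, expressed via projective resolutions. -/
def ExtVanish (X Y : ModuleCat.{u} B) : ℕ → Prop
  | 0 => Subsingleton (X →ₗ[B] Y)
  | (i+1) => ∀ R : ProjRes B X, ∀ f : R.P (i+1) →ₗ[B] Y,
      f ∘ₗ R.d (i+1) = 0 → ∃ g : R.P i →ₗ[B] Y, f = g ∘ₗ R.d i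

/-- `Q` is self-orthogonal: `Ext^i(Q, Q) = 0` for all `i > 0`. -/
def SelfOrth (Q : ModuleCat.{u} B) : Prop := ∀ i, 1 ≤ i → ExtVanish B Q Q i

/-- `Z` is a (first, minimal) syzygy of `X`. -/
def IsSyzygyOf (X Z : ModuleCat.{u} B) : Prop :=
  ∃ (P : ModuleCat.{u} B) (p : P →ₗ[B] X), IsProjCover B p ∧
    Nonempty (Z ≃ₗ[B] LinearMap.ker p)

/-- `Z` is an `n`-th syzygy `Ω^n X`. -/
def IsOmegaOf : ℕ → ModuleCat.{u} B → ModuleCat.{u} B → Prop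
  | 0, X, Z => Nonempty (Z ≃ₗ[B] X)
  | (n+1), X, Z => ∃ Y, IsSyzygyOf B X Y ∧ IsOmegaOf n Y Z

/-- `Z` is a (first, minimal) cosyzygy of `X`. -/
def IsCosyzygyOf (X Z : ModuleCat.{u} B) : Prop :=
  ∃ (I : ModuleCat.{u} B) (ι : X →ₗ[B] I), IsInjEnvelope B ι ∧
    Nonempty (Z ≃ₗ[B] (I ⧸ LinearMap.range ι))

/-- `Z` is an `n`-th cosyzygy `Ω^{-n} X`. -/
def IsOmegaInvOf : ℕ → ModuleCat.{u} B → ModuleCat.{u} B → Prop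
  | 0, X, Z => Nonempty (Z ≃ₗ[B] X)
  | (n+1), X, Z => ∃ Y, IsCosyzygyOf B X Y ∧ IsOmegaInvOf n Y Z

/-- Precomposition with `g`, as a map of right `B`-modules `Hom(P₀,B) → Hom(P₁,B)`. -/
def lprecomp {P1 P0 : ModuleCat.{u} B} (g : P1 →ₗ[B] P0) :
    (P0 →ₗ[B] B) →ₗ[Bᵐᵒᵖ] (P1 →ₗ[B] B) where
  toFun h := h ∘ₗ g
  map_add' _ _ := rfl
  map_smul' _ _ := rfl

/-- `T` is a transpose `Tr X` (computed from a minimal projective presentation). -/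
def IsTransposeOf (X : ModuleCat.{u} B) (T : ModuleCat.{u} Bᵐᵒᵖ) : Prop :=
  ∃ (P1 P0 : ModuleCat.{u} B) (g : P1 →ₗ[B] P0) (p : P0 →ₗ[B] X),
    IsProjCover B p ∧ Module.Projective B P1 ∧ Function.Exact g p ∧
    Superfluous B (LinearMap.ker g) ∧
    Nonempty (T ≃ₗ[Bᵐᵒᵖ] ((P1 →ₗ[B] B) ⧸ LinearMap.range (lprecomp B g)))

/-- The canonical ring homomorphism `B →+* Bᵐᵒᵖᵐᵒᵖ`. -/
def opOpHom : B →+* Bᵐᵒᵖᵐᵒᵖ where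
  toFun b := op (op b)
  map_one' := rfl
  map_mul' _ _ := rfl
  map_zero' := rfl
  map_add' _ _ := rfl


/-- An `F_Mo`-projective resolution: terms in `add(B ⊕ Mo)`, exact, and remaining
exact under `Hom(Mo, −)`. -/
structure FProjRes (Mo X : ModuleCat.{u} B) where
  P : ℕ → ModuleCat.{u} B
  d : ∀ j, P (j+1) →ₗ[B] P j
  aug : P 0 →ₗ[B] X
  mem : ∀ j, InAdd B (ModuleCat.of B (B × Mo)) (P j)
  augSurj : Function.Surjective aug
  exact0 : Function.Exact (d 0) aug
  exact : ∀ j, Function.Exact (d (j+1)) (d j)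
  lift0 : ∀ f : Mo →ₗ[B] X, ∃ h : Mo →ₗ[B] P 0, aug ∘ₗ h = f
  lift1 : ∀ f : Mo →ₗ[B] P 0, aug ∘ₗ f = 0 → ∃ h : Mo →ₗ[B] P 1, d 0 ∘ₗ h = f
  lift : ∀ j, ∀ f : Mo →ₗ[B] P (j+1), d j ∘ₗ f = 0 →
    ∃ h : Mo →ₗ[B] P (j+2), d (j+1) ∘ₗ h = f

/-- Vanishing of the relative extension group `Ext^i_{F_Mo}(X, Y)`, computed via
`F_Mo`-projective resolutions. -/
def FExtVanish (Mo X Y : ModuleCat.{u} B) : ℕ → Prop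
  | 0 => True
  | (i+1) => ∀ R : FProjRes B Mo X, ∀ f : R.P (i+1) →ₗ[B] Y,
      f ∘ₗ R.d (i+1) = 0 → ∃ g : R.P i →ₗ[B] Y, f = g ∘ₗ R.d i

end RingDefs

section Duality
variable (k : Type u) [Field k] (B : Type u) [Ring B] [Algebra k B]

noncomputable instance kmod (X : ModuleCat.{u} B) : Module k X :=
  Module.compHom X (algebraMap k B)

instance kmodSMulComm (X : ModuleCat.{u} B) : SMulCommClass B k X :=
  ⟨fun b c x => by
    show b • ((algebraMap k B c) • x) = (algebraMap k B c) • (b • x)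
    rw [← mul_smul, ← mul_smul, Algebra.commutes]⟩

instance kmodTower (X : ModuleCat.{u} B) : IsScalarTower k B X :=
  ⟨fun c b x => by
    show (c • b) • x = (algebraMap k B c) • (b • x)
    rw [Algebra.smul_def, mul_smul]⟩

noncomputable instance dualModL (X : ModuleCat.{u} B) : Module Bᵐᵒᵖ (X →ₗ[k] k) where
  smul b φ := φ ∘ₗ (DistribMulAction.toLinearMap k X b.unop)
  one_smul φ := by
    ext x
    show φ ((1 : Bᵐᵒᵖ).unop • x) = φ x
    rw [unop_one, one_smul]
  mul_smul b c φ := by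
    ext x
    show φ ((b * c).unop • x) = φ (c.unop • b.unop • x)
    rw [unop_mul, mul_smul]
  smul_zero b := rfl
  smul_add b φ ψ := rfl
  add_smul b c φ := by
    ext x
    show φ ((b + c).unop • x) = φ (b.unop • x) + φ (c.unop • x)
    rw [unop_add, add_smul, map_add]
  zero_smul φ := by
    ext x
    show φ ((0 : Bᵐᵒᵖ).unop • x) = 0
    rw [unop_zero, zero_smul, map_zero]

/-- The standard duality `D = Hom_k(−, k)`, sending a left `B`-module to a right
`B`-module. -/
def Dop (X : ModuleCat.{u} B) : ModuleCat.{u} Bᵐᵒᵖ :=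
  ModuleCat.of Bᵐᵒᵖ (X →ₗ[k] k)

noncomputable instance dualModR (Y : ModuleCat.{u} Bᵐᵒᵖ) : Module B (Y →ₗ[k] k) where
  smul b φ := φ ∘ₗ (DistribMulAction.toLinearMap k Y (op b))
  one_smul φ := by
    ext x
    show φ ((op (1:B)) • x) = φ x
    rw [op_one, one_smul]
  mul_smul b c φ := by
    ext x
    show φ ((op (b * c)) • x) = φ ((op c) • (op b) • x)
    rw [op_mul, mul_smul]
  smul_zero b := rfl
  smul_add b φ ψ := rfl
  add_smul b c φ := by
    ext x
    show φ ((op (b + c)) • x) = φ ((op b) • x) + φ ((op c) • x)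
    rw [op_add, add_smul, map_add]
  zero_smul φ := by
    ext x
    show φ ((op (0 : B)) • x) = 0
    rw [op_zero, zero_smul, map_zero]

/-- The standard duality `D = Hom_k(−, k)`, sending a right `B`-module to a left
`B`-module. -/
def Dunop (Y : ModuleCat.{u} Bᵐᵒᵖ) : ModuleCat.{u} B :=
  ModuleCat.of B (Y →ₗ[k] k)

/-- `D(B_B)`, the standard injective cogenerator of `B`-Mod. -/
def Dcogen : ModuleCat.{u} B := Dunop k B (ModuleCat.of Bᵐᵒᵖ B)

/-- `T ≅ τ X = D Tr X`, the Auslander–Reiten translate. -/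
def IsTauOf (X T : ModuleCat.{u} B) : Prop :=
  ∃ Tr : ModuleCat.{u} Bᵐᵒᵖ, IsTransposeOf B X Tr ∧ Nonempty (T ≃ₗ[B] Dunop k B Tr)

/-- `T ≅ τ_n X = τ Ω^{n-1} X`. -/
def IsTauN (n : ℕ) (X T : ModuleCat.{u} B) : Prop :=
  ∃ Z, IsOmegaOf B (n-1) X Z ∧ IsTauOf k B Z T

/-- `T ≅ τ⁻ X = Tr D X`, the inverse Auslander–Reiten translate. -/
def IsTauInvOf (X T : ModuleCat.{u} B) : Prop :=
  ∃ Tr2 : ModuleCat.{u} Bᵐᵒᵖᵐᵒᵖ, IsTransposeOf Bᵐᵒᵖ (Dop k B X) Tr2 ∧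
    Nonempty (T ≃ₗ[B] ((ModuleCat.restrictScalars (opOpHom B)).obj Tr2))

/-- `T ≅ τ⁻_n X = τ⁻ Ω^{-(n-1)} X`. -/
def IsTauInvN (n : ℕ) (X T : ModuleCat.{u} B) : Prop :=
  ∃ Z, IsOmegaInvOf B (n-1) X Z ∧ IsTauInvOf k B Z T

/-- The Nakayama functor `ν = D Hom_B(−, B)` (on objects). -/
def nu (X : ModuleCat.{u} B) : ModuleCat.{u} B :=
  Dunop k B (ModuleCat.of Bᵐᵒᵖ (X →ₗ[B] B))

/-- The inverse Nakayama functor `ν⁻ = Hom_B(D(−), B)` (on objects). -/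
def nuInv (X : ModuleCat.{u} B) : ModuleCat.{u} B :=
  (ModuleCat.restrictScalars (opOpHom B)).obj
    (ModuleCat.of Bᵐᵒᵖᵐᵒᵖ ((Dop k B X) →ₗ[Bᵐᵒᵖ] Bᵐᵒᵖ))

/-- Relative `add Q`-dimension of `X` is at most `m`. -/
def RelAddDimLE (Q X : ModuleCat.{u} B) (m : ℕ) : Prop :=
  ResLE B Q (InAdd B Q) X m

/-- Relative `add Q`-codimension of `X` is at most `m`. -/
def RelAddCodimLE (Q X : ModuleCat.{u} B) (m : ℕ) : Prop :=
  CoresLE B Q (InAdd B Q) X m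

/-- `Q` is an `l`-quasi-generator (without minimality of `l`). -/
def QuasiGenLE (Q : ModuleCat.{u} B) (l : ℕ) : Prop :=
  CoresLE B Q (InAdd B Q) (ModuleCat.of B B) l

/-- `Q` is an `l`-quasi-generator: `l` is minimal. -/
def IsQuasiGen (Q : ModuleCat.{u} B) (l : ℕ) : Prop :=
  QuasiGenLE B Q l ∧ ∀ j, QuasiGenLE B Q j → l ≤ j

/-- `Q` is an `m`-quasi-cogenerator (without minimality of `m`). -/
def QuasiCogenLE (Q : ModuleCat.{u} B) (m : ℕ) : Prop :=
  ResLE B Q (InAdd B Q) (Dcogen k B) m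

/-- `Q` is an `m`-quasi-cogenerator: `m` is minimal. -/
def IsQuasiCogen (Q : ModuleCat.{u} B) (m : ℕ) : Prop :=
  QuasiCogenLE k B Q m ∧ ∀ j, QuasiCogenLE k B Q j → m ≤ j

/-- `(B, Q)` is a relative `n`-Auslander–Gorenstein pair. -/
def IsRelAGPair (Q : ModuleCat.{u} B) (n : ℕ) : Prop :=
  idLE B (ModuleCat.of B B) n ∧ idLE Bᵐᵒᵖ (ModuleCat.of Bᵐᵒᵖ Bᵐᵒᵖ) n ∧
  SelfOrth B Q ∧ domdimGE B Q (ModuleCat.of B B) n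

/-- `Q` is an `(n, m, l)`-quasi-precluster tilting module. -/
def IsQPCT (Q : ModuleCat.{u} B) (n m l : ℕ) : Prop :=
  (∀ i, 1 ≤ i → i ≤ n - 2 → ExtVanish B Q Q i) ∧
  IsQuasiGen B Q l ∧
  IsQuasiCogen k B Q m ∧
  (∃ T, IsTauN k B (n - m - 1) Q T ∧ RelAddDimLE B Q T m) ∧
  (∃ T, IsTauInvN k B (n - l - 1) Q T ∧ RelAddCodimLE B Q T l)

/-- Precomposition with `g`, as a `k`-linear map between Hom spaces. -/
def pcompk {X Y Z : ModuleCat.{u} B} (g : X →ₗ[B] Y) :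
    (Y →ₗ[B] Z) →ₗ[k] (X →ₗ[B] Z) where
  toFun h := h ∘ₗ g
  map_add' _ _ := rfl
  map_smul' _ _ := rfl


/-- `I` is an injective object for the exact structure `F_Mo`: it lies in
`add(DB ⊕ τ Mo)`. -/
def IsFInj (Mo I : ModuleCat.{u} B) : Prop :=
  ∃ T, IsTauOf k B Mo T ∧ InAdd B (ModuleCat.of B ((Dcogen k B) × T)) I

/-- `T` is an `F_Mo`-cotilting object: finite relative injective dimension, no relative
self-extensions, and the relative injectives `DB ⊕ τ Mo` admit a finite `F_Mo`-exact
resolution by objects of `add T`. -/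
def FCotilting (Mo T : ModuleCat.{u} B) : Prop :=
  (∃ r, CoresLE B Mo (IsFInj k B Mo) T r) ∧
  (∀ i, 1 ≤ i → FExtVanish B Mo T T i) ∧
  (∃ τM, IsTauOf k B Mo τM ∧
    ∃ r, ResLE B Mo (InAdd B T) (ModuleCat.of B ((Dcogen k B) × τM)) r)

end Duality

section EndStuff
variable (A : Type u) [Ring A] (Q : ModuleCat.{u} A)

/-- The canonical ring homomorphism `A → End_{End_A(Q)}(Q)`. -/
def toEndE : A →+* Module.End (Module.End A Q) Q where
  toFun a :=
    { toFun := fun q => a • q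
      map_add' := fun x y => smul_add a x y
      map_smul' := fun e q => (e.map_smul a q).symm }
  map_one' := by ext q; exact one_smul A q
  map_mul' x y := by ext q; exact mul_smul x y q
  map_zero' := by ext q; exact zero_smul A q
  map_add' x y := by ext q; exact add_smul x y q

/-- `Hom_A(Q, X)` as a left module over `End_A(Q)ᵐᵒᵖ` (i.e. a left `Λ`-module) by
precomposition. -/
noncomputable instance homPrecompMod (X : ModuleCat.{u} A) :
    Module (Module.End A Q)ᵐᵒᵖ (Q →ₗ[A] X) where
  smul e f := f ∘ₗ e.unop
  one_smul f := by ext q; rfl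
  mul_smul e e' f := by ext q; rfl
  smul_zero e := rfl
  smul_add e f g := rfl
  add_smul e e' f := by ext q; exact map_add f _ _
  zero_smul f := by ext q; exact map_zero f

/-- The actions of `A` and of `End_A(Q)` on `Q` commute. -/
instance endSMulComm : SMulCommClass (Module.End A Q) A Q :=
  ⟨fun e a q => e.map_smul a q⟩

instance endSMulComm' : SMulCommClass A (Module.End A Q) Q :=
  ⟨fun a e q => (e.map_smul a q).symm⟩

end EndStuff

end Paper
end

section Part1
open MulOpposite
open Paper CategoryTheory Abelian

namespace PaperAux
section ExtHelpers
variable {A : Type} [Ring A]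

abbrev EV (X Y : ModuleCat.{0} A) (i : ℕ) : Prop := Subsingleton (Ext.{0} X Y i)

lemma sexact {X Y Z : ModuleCat.{0} A} (f : X →ₗ[A] Y) (g : Y →ₗ[A] Z)
    (hf : Function.Injective f) (hfg : Function.Exact f g) (hg : Function.Surjective g) :
    (ShortComplex.mk (ModuleCat.ofHom f) (ModuleCat.ofHom g)
      (by ext x; exact hfg.apply_apply_eq_zero x)).ShortExact where
  exact := (ShortComplex.ShortExact.moduleCat_exact_iff_function_exact _).2 hfg
  mono_f := (ModuleCat.mono_iff_injective _).2 hf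
  epi_g := (ModuleCat.epi_iff_surjective _).2 hg

variable {X1 X2 X3 : ModuleCat.{0} A} (f : X1 →ₗ[A] X2) (g : X2 →ₗ[A] X3)
    (hf : Function.Injective f) (hfg : Function.Exact f g) (hg : Function.Surjective g)
include hf hfg hg

lemma ev_cov3 {X : ModuleCat.{0} A} {i : ℕ} (h2 : EV X X2 i) (h1 : EV X X1 (i+1)) :
    EV X X3 i := by
  refine subsingleton_of_forall_eq 0 fun e => ?_
  obtain ⟨y, rfl⟩ := Ext.covariant_sequence_exact₃ X (sexact f g hf hfg hg) e rfl (h1.elim _ _)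
  have : y = 0 := h2.elim _ _
  rw [this, Ext.zero_comp]

lemma ev_con1 {Y : ModuleCat.{0} A} {i : ℕ} (h2 : EV X2 Y i) (h3 : EV X3 Y (i+1)) :
    EV X1 Y i := by
  refine subsingleton_of_forall_eq 0 fun e => ?_
  obtain ⟨y, rfl⟩ := Ext.contravariant_sequence_exact₁ (sexact f g hf hfg hg) Y e
    (add_comm 1 i) (h3.elim _ _)
  have : y = 0 := h2.elim _ _
  rw [this, Ext.comp_zero]

lemma ev_con3 {Y : ModuleCat.{0} A} {i : ℕ} (h2 : EV X2 Y (i+1)) (h1 : EV X1 Y i) :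
    EV X3 Y (i+1) := by
  refine subsingleton_of_forall_eq 0 fun e => ?_
  obtain ⟨y, rfl⟩ := Ext.contravariant_sequence_exact₃ (sexact f g hf hfg hg) Y e
    (h2.elim _ _) (add_comm 1 i)
  have : y = 0 := h1.elim _ _
  rw [this, Ext.comp_zero]

lemma lift_of_ev {X : ModuleCat.{0} A} (h : EV X X1 1) (φ : X →ₗ[A] X3) :
    ∃ ψ : X →ₗ[A] X2, g ∘ₗ ψ = φ := by
  obtain ⟨y, hy⟩ := Ext.covariant_sequence_exact₃ X (sexact f g hf hfg hg)
    (Ext.mk₀ (ModuleCat.ofHom φ)) (zero_add 1) (h.elim _ _)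
  obtain ⟨ψ, rfl⟩ := Ext.homEquiv₀.symm.surjective y
  refine ⟨ψ.hom, ?_⟩
  have : ψ ≫ ModuleCat.ofHom g = ModuleCat.ofHom φ :=
    Ext.homEquiv₀.symm.injective (by simpa using hy)
  exact congrArg ModuleCat.Hom.hom this

lemma extend_of_ev {Y : ModuleCat.{0} A} (h : EV X3 Y 1) (φ : X1 →ₗ[A] Y) :
    ∃ ψ : X2 →ₗ[A] Y, ψ ∘ₗ f = φ := by
  obtain ⟨y, hy⟩ := Ext.contravariant_sequence_exact₁ (sexact f g hf hfg hg) Y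
    (Ext.mk₀ (ModuleCat.ofHom φ)) (add_zero 1) (h.elim _ _)
  obtain ⟨ψ, rfl⟩ := Ext.homEquiv₀.symm.surjective y
  refine ⟨ψ.hom, ?_⟩
  have : ModuleCat.ofHom f ≫ ψ = ModuleCat.ofHom φ :=
    Ext.homEquiv₀.symm.injective (by simpa using hy)
  exact congrArg ModuleCat.Hom.hom this

/-- converse of `extend_of_ev` when the middle is projective -/
lemma ev_one_of_extend {Y : ModuleCat.{0} A} (hP : Module.Projective A X2)
    (h : ∀ φ : X1 →ₗ[A] Y, ∃ ψ : X2 →ₗ[A] Y, ψ ∘ₗ f = φ) : EV X3 Y 1 := by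
  have : Projective X2 := (IsProjective.iff_projective _).1 hP
  refine subsingleton_of_forall_eq 0 fun e => ?_
  obtain ⟨y, rfl⟩ := Ext.contravariant_sequence_exact₃ (sexact f g hf hfg hg) Y e
    (Ext.eq_zero_of_projective _) (add_zero 1)
  obtain ⟨φ, rfl⟩ := Ext.homEquiv₀.symm.surjective y
  obtain ⟨ψ, hψ⟩ := h φ.hom
  have h1 : φ = ModuleCat.ofHom f ≫ ModuleCat.ofHom ψ := by
    ext x; exact (LinearMap.congr_fun hψ x).symm
  have h2 : Ext.homEquiv₀.symm φ = (Ext.mk₀ (ModuleCat.ofHom f)).comp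
      (Ext.mk₀ (ModuleCat.ofHom ψ)) (zero_add 0) := by
    rw [Ext.mk₀_comp_mk₀, ← h1]; rfl
  rw [h2]
  exact (sexact f g hf hfg hg).extClass_comp_assoc _

end ExtHelpers

section ExtHelpers2
variable {A : Type} [Ring A]

lemma inAdd_sum {Q M : ModuleCat.{0} A} (h : InAdd A Q M) :
    ∃ (r : ℕ) (s : Fin r → (M ⟶ Q)) (t : Fin r → (Q ⟶ M)), 𝟙 M = ∑ i, s i ≫ t i := by
  obtain ⟨r, s, t, h⟩ := h
  refine ⟨r, fun i => ModuleCat.ofHom (LinearMap.proj i ∘ₗ s),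
    fun i => ModuleCat.ofHom (t ∘ₗ LinearMap.single A (fun _ : Fin r => (Q : Type)) i), ?_⟩
  ext x
  have h1 := LinearMap.congr_fun h x
  simp only [ModuleCat.hom_sum, LinearMap.sum_apply, ModuleCat.hom_comp, ModuleCat.hom_ofHom,
    LinearMap.comp_apply, ModuleCat.hom_id]
  rw [← map_sum]
  conv_lhs => rw [← h1]
  simp only [LinearMap.comp_apply]
  congr 1
  exact (LinearMap.sum_single_apply _ _).symm

lemma ev_add_right {Q M X : ModuleCat.{0} A} {i : ℕ} (h : InAdd A Q M) (hQ : EV X Q i) :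
    EV X M i := by
  obtain ⟨r, s, t, h⟩ := inAdd_sum h
  refine subsingleton_of_forall_eq 0 fun e => ?_
  rw [← e.comp_mk₀_id, h, Ext.mk₀_sum, Ext.comp_sum]
  refine Finset.sum_eq_zero fun j _ => ?_
  rw [← Ext.mk₀_comp_mk₀, ← Ext.comp_assoc_of_third_deg_zero]
  have : e.comp (Ext.mk₀ (s j)) (add_zero i) = 0 := hQ.elim _ _
  rw [this, Ext.zero_comp]

lemma ev_add_left {Q M X : ModuleCat.{0} A} {i : ℕ} (h : InAdd A Q M) (hQ : EV Q X i) :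
    EV M X i := by
  obtain ⟨r, s, t, h⟩ := inAdd_sum h
  refine subsingleton_of_forall_eq 0 fun e => ?_
  rw [← e.mk₀_id_comp, h, Ext.mk₀_sum, Ext.sum_comp]
  refine Finset.sum_eq_zero fun j _ => ?_
  rw [← Ext.mk₀_comp_mk₀, Ext.comp_assoc_of_second_deg_zero]
  have : (Ext.mk₀ (t j)).comp e (zero_add i) = 0 := hQ.elim _ _
  rw [this, Ext.comp_zero]

end ExtHelpers2
end PaperAux
end Part1

section Part2
open MulOpposite
open Paper CategoryTheory Abelian

namespace PaperAux
section Conv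
variable {A : Type} [Ring A]

lemma proj_of_sub (P : ModuleCat.{0} A) [Subsingleton P] : Module.Projective A P :=
  have : Module.Free A P := Module.Free.of_subsingleton A P
  Module.Projective.of_free

/-- the map onto the kernel -/
lemma cod_exact {P1 P0 X : ModuleCat.{0} A} (d : P1 →ₗ[A] P0) (a : P0 →ₗ[A] X)
    (h : Function.Exact d a) :
    ∃ a' : P1 →ₗ[A] (ModuleCat.of A (LinearMap.ker a)), Function.Surjective a' ∧
      ∀ x, (a' x : P0) = d x := by
  refine ⟨d.codRestrict (LinearMap.ker a) fun x => h.apply_apply_eq_zero x, ?_, fun _ => rfl⟩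
  rintro ⟨y, hy⟩
  obtain ⟨x, hx⟩ := (h y).1 hy
  exact ⟨x, Subtype.ext hx⟩

noncomputable def _root_.Paper.ProjRes.shift {X : ModuleCat.{0} A} (R : ProjRes A X) :
    ProjRes A (ModuleCat.of A (LinearMap.ker R.aug)) where
  P j := R.P (j+1)
  d j := R.d (j+1)
  aug := (cod_exact (R.d 0) R.aug R.exact0).choose
  proj j := R.proj (j+1)
  augSurj := (cod_exact (R.d 0) R.aug R.exact0).choose_spec.1
  exact0 := by
    have h := (cod_exact (R.d 0) R.aug R.exact0).choose_spec.2
    intro x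
    rw [← R.exact 0 x, ← h x]
    exact (Submodule.coe_eq_zero).symm
  exact j := R.exact (j+1)

lemma ev_of_projRes {Y : ModuleCat.{0} A} (i : ℕ) : ∀ {X : ModuleCat.{0} A} (R : ProjRes A X),
    (∀ f : R.P (i+1) →ₗ[A] Y, f ∘ₗ R.d (i+1) = 0 → ∃ g : R.P i →ₗ[A] Y, f = g ∘ₗ R.d i) →
    EV X Y (i+1) := by
  induction i with
  | zero =>
    intro X R h
    obtain ⟨a', ha', ha⟩ := cod_exact (R.d 0) R.aug R.exact0
    refine ev_one_of_extend (X1 := ModuleCat.of A (LinearMap.ker R.aug))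
      (LinearMap.ker R.aug).subtype R.aug (Submodule.injective_subtype _)
      (LinearMap.exact_subtype_ker_map _) R.augSurj (R.proj 0) fun φ => ?_
    obtain ⟨g, hg⟩ := h (φ ∘ₗ a') (by
      ext x
      have : a' (R.d 1 x) = 0 := by
        apply Subtype.ext
        rw [ha]
        exact (R.exact 0).apply_apply_eq_zero x
      simp [this])
    refine ⟨g, ?_⟩
    ext y
    obtain ⟨x, rfl⟩ := ha' y
    have := LinearMap.congr_fun hg x
    simp only [LinearMap.comp_apply] at this ⊢
    rw [this, ← ha]; rfl
  | succ i ih =>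
    intro X R h
    have : Projective (R.P 0) := (IsProjective.iff_projective _).1 (R.proj 0)
    refine ev_con3 (X1 := ModuleCat.of A (LinearMap.ker R.aug))
      (LinearMap.ker R.aug).subtype R.aug (Submodule.injective_subtype _)
      (LinearMap.exact_subtype_ker_map _) R.augSurj
      (Ext.subsingleton_of_projective _ _ _) (ih R.shift h)

lemma exists_projRes {X : ModuleCat.{0} A} {n : ℕ} (h : pdLE A X n) :
    Nonempty (ProjRes A X) := by
  obtain ⟨P, d, aug, h1, h2, h3, h4, h5, -⟩ := h
  refine ⟨⟨P, d, aug, fun j => ?_, h3, h4, h5⟩⟩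
  by_cases hj : j ≤ n
  · exact h1 j hj
  · have := h2 j (by omega)
    exact proj_of_sub _

lemma ev_of_selfOrth {Q : ModuleCat.{0} A} {n : ℕ} (hpd : pdLE A Q n) (h : SelfOrth A Q)
    (i : ℕ) (hi : 1 ≤ i) : EV Q Q i := by
  obtain ⟨R⟩ := exists_projRes hpd
  obtain ⟨i, rfl⟩ : ∃ j, i = j + 1 := ⟨i - 1, by omega⟩
  exact ev_of_projRes i R (h (i+1) hi R)

lemma hasPD_of_projRes (n : ℕ) : ∀ {X : ModuleCat.{0} A} (R : ProjRes A X),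
    (∀ j, n < j → Subsingleton (R.P j)) → HasProjectiveDimensionLT X (n+1) := by
  induction n with
  | zero =>
    intro X R h
    have inj : Function.Injective R.aug := by
      rw [injective_iff_map_eq_zero]
      intro x hx
      obtain ⟨y, rfl⟩ := (R.exact0 x).1 hx
      have := h 1 (by omega)
      rw [Subsingleton.elim y 0, map_zero]
    let e := LinearEquiv.ofBijective R.aug ⟨inj, R.augSurj⟩
    have := R.proj 0
    have : Module.Projective A X := Module.Projective.of_equiv e
    have : Projective X := (IsProjective.iff_projective _).1 this
    infer_instance
  | succ n ih =>
    intro X R h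
    have : Projective (R.P 0) := (IsProjective.iff_projective _).1 (R.proj 0)
    have s := sexact (X := ModuleCat.of A (LinearMap.ker R.aug))
      (LinearMap.ker R.aug).subtype R.aug (Submodule.injective_subtype _)
      (LinearMap.exact_subtype_ker_map _) R.augSurj
    exact s.hasProjectiveDimensionLT_X₃ (n+1) (ih R.shift fun j hj => h (j+1) (by omega))
      (hasProjectiveDimensionLT_of_ge (R.P 0) 1 _ (by omega))

lemma hasPD_of_pdLE {X : ModuleCat.{0} A} {n : ℕ} (h : pdLE A X n) :
    HasProjectiveDimensionLT X (n+1) := by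
  obtain ⟨P, d, aug, h1, h2, h3, h4, h5, -⟩ := h
  refine hasPD_of_projRes n ⟨P, d, aug, fun j => ?_, h3, h4, h5⟩ h2
  by_cases hj : j ≤ n
  · exact h1 j hj
  · have := h2 j (by omega)
    exact proj_of_sub _

lemma hasID_aux (n : ℕ) : ∀ {X : ModuleCat.{0} A} (M : ℕ → ModuleCat.{0} A) (ι : X →ₗ[A] M 0)
    (d : ∀ j, M j →ₗ[A] M (j+1)), (∀ j, j ≤ n → Module.Injective A (M j)) →
    (∀ j, n < j → Subsingleton (M j)) → Function.Injective ι → Function.Exact ι (d 0) →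
    (∀ j, Function.Exact (d j) (d (j+1))) → HasInjectiveDimensionLT X (n+1) := by
  induction n with
  | zero =>
    intro X M ι d h1 h2 h3 h4 h5
    have sur : Function.Surjective ι := by
      intro x
      have := h2 1 (by omega)
      exact (h4 x).1 (Subsingleton.elim _ _)
    let e := LinearEquiv.ofBijective ι ⟨h3, sur⟩
    have := h1 0 le_rfl
    have : Injective (M 0) := (Module.injective_iff_injective_object _ _).1 this
    have : HasInjectiveDimensionLT (M 0) 1 := inferInstance
    exact hasInjectiveDimensionLT_of_iso e.symm.toModuleIso 1
  | succ n ih =>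
    intro X M ι d h1 h2 h3 h4 h5
    have : Injective (M 0) := (Module.injective_iff_injective_object _ _).1 (h1 0 (by omega))
    have s := sexact (Z := ModuleCat.of A (M 0 ⧸ LinearMap.range ι)) ι
      (LinearMap.range ι).mkQ h3 (LinearMap.exact_map_mkQ_range ι) (Submodule.mkQ_surjective _)
    have hle : LinearMap.range ι ≤ LinearMap.ker (d 0) := by
      rintro _ ⟨x, rfl⟩; exact h4.apply_apply_eq_zero x
    refine s.hasInjectiveDimensionLT_X₁ (n+1) ?_
      (hasInjectiveDimensionLT_of_ge (M 0) 1 _ (by omega))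
    refine ih (X := ModuleCat.of A (M 0 ⧸ LinearMap.range ι)) (fun j => M (j+1))
      ((LinearMap.range ι).liftQ (d 0) hle) (fun j => d (j+1))
      (fun j hj => h1 (j+1) (by omega)) (fun j hj => h2 (j+1) (by omega)) ?_ ?_
      (fun j => h5 (j+1))
    · rw [← LinearMap.ker_eq_bot]
      apply Submodule.ker_liftQ_eq_bot
      intro x hx; exact (h4 x).1 hx
    · intro y
      rw [h5 0 y]
      constructor
      · rintro ⟨x, rfl⟩; exact ⟨Submodule.Quotient.mk x, rfl⟩
      · rintro ⟨x, rfl⟩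
        obtain ⟨x, rfl⟩ := Submodule.mkQ_surjective _ x
        exact ⟨x, rfl⟩

lemma hasID_of_idLE {X : ModuleCat.{0} A} {n : ℕ} (h : idLE A X n) :
    HasInjectiveDimensionLT X (n+1) := by
  obtain ⟨M, ι, d, h1, h2, h3, h4, h5, -⟩ := h
  exact hasID_aux n M ι d h1 h2 h3 h4 h5

end Conv
end PaperAux
end Part2

section Part3
open MulOpposite
open Paper CategoryTheory Abelian

noncomputable section
namespace PaperAux
section Fd
variable (k : Type) [Field k] (B : Type) [Ring B] [Algebra k B]

/-- The dual of the right regular module, as a left module. -/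
def DBt : Type := B →ₗ[k] k

instance : AddCommGroup (DBt k B) := inferInstanceAs (AddCommGroup (B →ₗ[k] k))

variable {k B}
/-- view as a linear map -/
def DBt.ev (φ : DBt k B) : B →ₗ[k] k := φ

lemma DBt.ext {φ ψ : DBt k B} (h : ∀ b, φ.ev b = ψ.ev b) : φ = ψ := LinearMap.ext h

instance : Module B (DBt k B) where
  smul b φ := φ.ev ∘ₗ LinearMap.mulRight k b
  one_smul φ := DBt.ext fun b => congrArg φ.ev (mul_one b)
  mul_smul b c φ := DBt.ext fun x => congrArg φ.ev (mul_assoc x b c).symm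
  smul_zero b := rfl
  smul_add b φ ψ := rfl
  add_smul b c φ := DBt.ext fun x => (congrArg φ.ev (mul_add x b c)).trans (map_add _ _ _)
  zero_smul φ := DBt.ext fun x => (congrArg φ.ev (mul_zero x)).trans (map_zero _)

@[simp] lemma DBt.smul_ev (b : B) (φ : DBt k B) (x : B) : (b • φ).ev x = φ.ev (x * b) := rfl
@[simp] lemma DBt.add_ev (φ ψ : DBt k B) (x : B) : (φ + ψ).ev x = φ.ev x + ψ.ev x := rfl
@[simp] lemma DBt.zero_ev (x : B) : (0 : DBt k B).ev x = 0 := rfl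

variable (k B) in
/-- bundled -/
abbrev DB : ModuleCat.{0} B := ModuleCat.of B (DBt k B)

section unb
variable {X Y : Type} [AddCommGroup X] [Module B X] [Module k X] [IsScalarTower k B X]
  [AddCommGroup Y] [Module B Y] [Module k Y] [IsScalarTower k B Y]

/-- adjunction map `Hom_k(X,k) → Hom_B(X,DB)` -/
def toD (φ : X →ₗ[k] k) : X →ₗ[B] DBt k B where
  toFun x := show B →ₗ[k] k from
    { toFun := fun (b : B) => φ (b • x)
      map_add' := fun (a b : B) => by rw [add_smul, map_add]
      map_smul' := fun c (b : B) => by rw [RingHom.id_apply, ← map_smul, ← smul_assoc] }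
  map_add' x y := by
    refine DBt.ext fun (b : B) => ?_
    show φ (b • (x + y)) = φ (b • x) + φ (b • y)
    rw [smul_add, map_add]
  map_smul' a x := by
    refine DBt.ext fun (b : B) => ?_
    show φ (b • a • x) = φ ((b * a) • x)
    rw [mul_smul]

@[simp] lemma toD_ev (φ : X →ₗ[k] k) (x : X) (b : B) : (toD φ x).ev b = φ (b • x) := rfl

/-- inverse of `toD` -/
def fromD (g : X →ₗ[B] DBt k B) : X →ₗ[k] k where
  toFun x := (g x).ev 1
  map_add' x y := by rw [map_add]; rfl
  map_smul' c x := by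
    rw [← one_smul B x, ← smul_assoc, map_smul, one_smul, DBt.smul_ev, one_mul, map_smul]; rfl

@[simp] lemma fromD_apply (g : X →ₗ[B] DBt k B) (x : X) : fromD g x = (g x).ev 1 := rfl

lemma toD_fromD (g : X →ₗ[B] DBt k B) : toD (fromD g) = g := by
  refine LinearMap.ext fun x => DBt.ext fun (b : B) => ?_
  rw [toD_ev, fromD_apply, map_smul, DBt.smul_ev, one_mul]

lemma fromD_toD (φ : X →ₗ[k] k) : fromD (B := B) (toD φ) = φ := by
  refine LinearMap.ext fun x => ?_
  simp
end unb

lemma extend_k {X Y : Type} [AddCommGroup X] [Module k X] [AddCommGroup Y] [Module k Y]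
    (f : X →ₗ[k] Y) (hf : Function.Injective f) (φ : X →ₗ[k] k) : ∃ ψ : Y →ₗ[k] k, ψ ∘ₗ f = φ := by
  obtain ⟨g, hg⟩ := f.exists_leftInverse_of_injective (LinearMap.ker_eq_bot.2 hf)
  exact ⟨φ ∘ₗ g, by rw [LinearMap.comp_assoc, hg, LinearMap.comp_id]⟩

lemma tower_compHom (X : Type) [AddCommGroup X] [Module B X] :
    letI := Module.compHom X (algebraMap k B)
    IsScalarTower k B X :=
  letI := Module.compHom X (algebraMap k B)
  ⟨fun c b x => by
    show (c • b) • x = (algebraMap k B c) • (b • x)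
    rw [Algebra.smul_def, mul_smul]⟩

variable (k B) in
lemma inj_D : Module.Injective B (DB k B) := by
  refine ⟨fun X Y _ _ _ _ f hf g => ?_⟩
  letI := Module.compHom X (algebraMap k B)
  letI := Module.compHom Y (algebraMap k B)
  haveI := tower_compHom (k := k) (B := B) X
  haveI := tower_compHom (k := k) (B := B) Y
  obtain ⟨ψ, hψ⟩ := extend_k (f.restrictScalars k) hf (fromD g)
  refine ⟨toD ψ, fun x => ?_⟩
  rw [← toD_fromD g, ← hψ]
  refine DBt.ext fun (b : B) => ?_
  simp

lemma inj_pow {I : ModuleCat.{0} B} (hI : Module.Injective B I) (r : ℕ) :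
    Module.Injective B (ModuleCat.of B (Fin r → I)) := by
  refine ⟨fun X Y _ _ _ _ f hf g => ?_⟩
  choose h hh using fun i : Fin r => hI.out f hf
    ((LinearMap.proj i : (Fin r → I) →ₗ[B] _) ∘ₗ g)
  exact ⟨LinearMap.pi h, fun x => funext fun i => hh i x⟩

variable [FiniteDimensional k B]

variable (k) in
lemma fd_of_finite (X : ModuleCat.{0} B) [Module.Finite B X] : Module.Finite k X :=
  Module.Finite.trans B X

variable (k) in
omit [FiniteDimensional k B] in
lemma finite_of_fd (X : ModuleCat.{0} B) [Module.Finite k X] : Module.Finite B X :=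
  Module.Finite.of_restrictScalars_finite k B X

variable (k B) in
instance finite_D : Module.Finite B (DBt k B) := by
  have h2 : Module.Finite k (B →ₗ[k] k) := inferInstance
  letI : Module k (DBt k B) := inferInstanceAs (Module k (B →ₗ[k] k))
  have h3 : Module.Finite k (DBt k B) := h2
  have : IsScalarTower k B (DBt k B) := ⟨fun c b φ => by
    refine DBt.ext fun x => ?_
    rw [DBt.smul_ev, mul_smul_comm, map_smul]; rfl⟩
  exact Module.Finite.of_restrictScalars_finite k B _

variable (k) in
include k in
lemma noeth (X : ModuleCat.{0} B) [Module.Finite B X] : IsNoetherian B X := by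
  have : IsNoetherian k B := inferInstance
  have : IsNoetherianRing B := isNoetherian_of_tower k this
  infer_instance

variable (k) in
lemma embed (X : ModuleCat.{0} B) [Module.Finite B X] :
    ∃ (r : ℕ) (i : X →ₗ[B] (Fin r → DB k B)), Function.Injective i := by
  have := fd_of_finite k X
  let b := Module.finBasis k X
  refine ⟨_, LinearMap.pi fun i => toD (b.coord i), ?_⟩
  rw [injective_iff_map_eq_zero]
  intro x hx
  apply b.ext_elem
  intro i
  have h1 := congrFun hx i
  have h2 : (toD (B := B) (b.coord i) x).ev 1 = (0 : DBt k B).ev 1 := congrArg (fun z => DBt.ev z 1) h1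
  simpa using h2

variable (k) in
lemma hom_gens (X Y : ModuleCat.{0} B) [Module.Finite B X] [Module.Finite B Y] :
    ∃ (r : ℕ) (F : Fin r → (X →ₗ[B] Y)), ∀ f : X →ₗ[B] Y, ∃ c : Fin r → k,
      f = ∑ i, c i • F i := by
  have := fd_of_finite k X
  have := fd_of_finite k Y
  let res : (X →ₗ[B] Y) →ₗ[k] (X →ₗ[k] Y) :=
    { toFun := fun f => f.restrictScalars k
      map_add' := fun _ _ => rfl
      map_smul' := fun _ _ => rfl }
  have hres : Function.Injective res := LinearMap.restrictScalars_injective k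
  have : Module.Finite k (X →ₗ[B] Y) := Module.Finite.of_injective res hres
  let b := Module.finBasis k (X →ₗ[B] Y)
  exact ⟨_, b, fun f => ⟨fun i => b.repr f i, (b.sum_repr f).symm⟩⟩

variable (k) in
include k in
lemma right_approx (Q X : ModuleCat.{0} B) [Module.Finite B Q] [Module.Finite B X] :
    ∃ (r : ℕ) (p : (Fin r → Q) →ₗ[B] X), ∀ f : Q →ₗ[B] X, ∃ h : Q →ₗ[B] (Fin r → Q),
      p ∘ₗ h = f := by
  obtain ⟨r, F, hF⟩ := hom_gens k Q X
  refine ⟨r, ∑ i, F i ∘ₗ LinearMap.proj i, fun f => ?_⟩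
  obtain ⟨c, rfl⟩ := hF f
  refine ⟨LinearMap.pi fun i => c i • LinearMap.id, ?_⟩
  ext x
  simp only [LinearMap.comp_apply, LinearMap.sum_apply, LinearMap.smul_apply, LinearMap.proj_apply,
    LinearMap.pi_apply, LinearMap.id_apply]
  exact Finset.sum_congr rfl fun i _ => (LinearMap.restrictScalars k (F i)).map_smul (c i) x

variable (k) in
include k in
lemma left_approx (X Q : ModuleCat.{0} B) [Module.Finite B Q] [Module.Finite B X] :
    ∃ (r : ℕ) (p : X →ₗ[B] (Fin r → Q)), ∀ f : X →ₗ[B] Q, ∃ h : (Fin r → Q) →ₗ[B] Q,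
      h ∘ₗ p = f := by
  obtain ⟨r, F, hF⟩ := hom_gens k X Q
  refine ⟨r, LinearMap.pi F, fun f => ?_⟩
  obtain ⟨c, rfl⟩ := hF f
  refine ⟨∑ i, c i • LinearMap.proj i, ?_⟩
  ext x
  simp only [LinearMap.comp_apply, LinearMap.sum_apply, LinearMap.smul_apply, LinearMap.proj_apply,
    LinearMap.pi_apply]

end Fd
end PaperAux
end
end Part3

section Part4
open MulOpposite
open Paper CategoryTheory Abelian

noncomputable section
namespace PaperAux
section FacSec
variable {A : Type} [Ring A]

/-- Maps which are sums of maps factoring through `Y` or `Q`. -/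
inductive Fac (Y Q X Z : ModuleCat.{0} A) : (X →ₗ[A] Z) → Prop
  | viaL (g : X →ₗ[A] Y) (h : Y →ₗ[A] Z) : Fac Y Q X Z (h ∘ₗ g)
  | viaR (g : X →ₗ[A] Q) (h : Q →ₗ[A] Z) : Fac Y Q X Z (h ∘ₗ g)
  | add (f g : X →ₗ[A] Z) : Fac Y Q X Z f → Fac Y Q X Z g → Fac Y Q X Z (f + g)

variable {Y Q X Z : ModuleCat.{0} A}

lemma Fac.zero : Fac Y Q X Z 0 := by
  have := Fac.viaL (Y := Y) (Q := Q) (X := X) (Z := Z) 0 0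
  simpa using this

lemma Fac.comp_right {X' : ModuleCat.{0} A} {f : X →ₗ[A] Z} (hf : Fac Y Q X Z f)
    (a : X' →ₗ[A] X) : Fac Y Q X' Z (f ∘ₗ a) := by
  induction hf with
  | viaL g h => rw [LinearMap.comp_assoc]; exact .viaL _ _
  | viaR g h => rw [LinearMap.comp_assoc]; exact .viaR _ _
  | add f g _ _ h1 h2 => rw [LinearMap.add_comp]; exact .add _ _ h1 h2

lemma Fac.comp_left {Z' : ModuleCat.{0} A} {f : X →ₗ[A] Z} (hf : Fac Y Q X Z f)
    (a : Z →ₗ[A] Z') : Fac Y Q X Z' (a ∘ₗ f) := by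
  induction hf with
  | viaL g h => rw [← LinearMap.comp_assoc]; exact .viaL _ _
  | viaR g h => rw [← LinearMap.comp_assoc]; exact .viaR _ _
  | add f g _ _ h1 h2 => rw [LinearMap.comp_add]; exact .add _ _ h1 h2

lemma Fac.of_id_left (h : Fac Y Q X X LinearMap.id) (f : X →ₗ[A] Z) : Fac Y Q X Z f := by
  simpa using h.comp_left f

lemma Fac.of_id_right (h : Fac Y Q Z Z LinearMap.id) (f : X →ₗ[A] Z) : Fac Y Q X Z f := by
  simpa using h.comp_right f

lemma Fac.trans {Y' Q' : ModuleCat.{0} A} {f : X →ₗ[A] Z} (hf : Fac Y Q X Z f)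
    (hY : Fac Y' Q' Y Y LinearMap.id) (hQ : Fac Y' Q' Q Q LinearMap.id) : Fac Y' Q' X Z f := by
  induction hf with
  | viaL g h => exact (hY.of_id_left h).comp_right g
  | viaR g h => exact (hQ.of_id_left h).comp_right g
  | add f g _ _ h1 h2 => exact .add _ _ h1 h2

lemma Fac.idL : Fac Y Q Y Y LinearMap.id := by
  simpa using Fac.viaL (Y := Y) (Q := Q) (X := Y) (Z := Y) LinearMap.id LinearMap.id

lemma Fac.idR : Fac Y Q Q Q LinearMap.id := by
  simpa using Fac.viaR (Y := Y) (Q := Q) (X := Q) (Z := Q) LinearMap.id LinearMap.id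

lemma Fac.sum {n : ℕ} (f : Fin n → (X →ₗ[A] Z)) (h : ∀ i, Fac Y Q X Z (f i)) :
    Fac Y Q X Z (∑ i, f i) := by
  induction n with
  | zero => simpa using Fac.zero
  | succ n ih => rw [Fin.sum_univ_succ]; exact .add _ _ (h 0) (ih _ fun i => h _)

lemma fac_of_inAdd (h : InAdd A Q X) : Fac Q Q X X LinearMap.id := by
  obtain ⟨r, s, t, h⟩ := inAdd_sum h
  have : (LinearMap.id : X →ₗ[A] X) = ∑ i, (t i).hom ∘ₗ (s i).hom := by
    have := congrArg ModuleCat.Hom.hom h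
    simpa [ModuleCat.hom_sum] using this
  rw [this]
  exact Fac.sum _ fun i => .viaL _ _

lemma exists_of_fac {f : X →ₗ[A] Z} (h : Fac Y Q X Z f) :
    ∃ (n : ℕ) (s : Fin n → (X →ₗ[A] (Y × Q))) (r : Fin n → ((Y × Q) →ₗ[A] Z)),
      f = ∑ i, r i ∘ₗ s i := by
  induction h with
  | viaL g h => exact ⟨1, fun _ => LinearMap.inl A Y Q ∘ₗ g, fun _ => h ∘ₗ LinearMap.fst A Y Q, by
      ext x; simp⟩
  | viaR g h => exact ⟨1, fun _ => LinearMap.inr A Y Q ∘ₗ g, fun _ => h ∘ₗ LinearMap.snd A Y Q, by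
      ext x; simp⟩
  | add f g _ _ h1 h2 =>
    obtain ⟨n, s, r, rfl⟩ := h1
    obtain ⟨m, s', r', rfl⟩ := h2
    refine ⟨n + m, Fin.append s s', Fin.append r r', ?_⟩
    rw [Fin.sum_univ_add]
    simp

lemma inAdd_of_fac (h : Fac Y Q X X LinearMap.id) :
    InAdd A (ModuleCat.of A (Y × Q)) X := by
  obtain ⟨n, s, r, h⟩ := exists_of_fac h
  refine ⟨n, LinearMap.pi s, ∑ i, r i ∘ₗ LinearMap.proj i, ?_⟩
  rw [h]
  ext x
  simp

lemma fac_of_inAdd_prod (h : InAdd A (ModuleCat.of A (Y × Q)) X) : Fac Y Q X X LinearMap.id := by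
  have h2 : Fac Y Q (ModuleCat.of A (Y × Q)) (ModuleCat.of A (Y × Q)) LinearMap.id := by
    have : (LinearMap.id : (Y × Q) →ₗ[A] (Y × Q)) =
      LinearMap.inl A Y Q ∘ₗ LinearMap.fst A Y Q + LinearMap.inr A Y Q ∘ₗ LinearMap.snd A Y Q := by
      ext x <;> simp
    rw [this]
    exact .add _ _ (.viaL (X := ModuleCat.of A (Y × Q)) (Z := ModuleCat.of A (Y × Q)) _ _)
      (.viaR (X := ModuleCat.of A (Y × Q)) (Z := ModuleCat.of A (Y × Q)) _ _)
  exact (fac_of_inAdd h).trans h2 h2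

lemma inAdd_of_fac' (h : Fac Q Q X X LinearMap.id) : InAdd A Q X := by
  obtain ⟨n, s, r, h⟩ := exists_of_fac h
  -- rewrite using both components
  refine ⟨n + n, LinearMap.pi (Fin.append (fun i => LinearMap.fst A Q Q ∘ₗ s i)
    (fun i => LinearMap.snd A Q Q ∘ₗ s i)),
    ∑ i, (Fin.append (fun i => r i ∘ₗ LinearMap.inl A Q Q)
      (fun i => r i ∘ₗ LinearMap.inr A Q Q) i) ∘ₗ LinearMap.proj i, ?_⟩
  rw [h]
  ext x
  simp only [LinearMap.comp_apply, LinearMap.sum_apply, LinearMap.proj_apply, LinearMap.pi_apply]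
  rw [Fin.sum_univ_add]
  simp only [Fin.append_left, Fin.append_right, LinearMap.comp_apply]
  rw [← Finset.sum_add_distrib]
  refine Finset.sum_congr rfl fun i _ => ?_
  rw [← map_add]
  congr 1
  simp

lemma inAdd_pow (r : ℕ) : InAdd A Q (ModuleCat.of A (Fin r → Q)) :=
  ⟨r, LinearMap.id, LinearMap.id, rfl⟩

lemma Fac.lift {N Y' M : ModuleCat.{0} A} {f : M →ₗ[A] Y'} (hf : Fac Q Q M Y' f)
    (p : N →ₗ[A] Y') (hp : ∀ f : Q →ₗ[A] Y', ∃ h : Q →ₗ[A] N, p ∘ₗ h = f) :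
    ∃ h : M →ₗ[A] N, p ∘ₗ h = f := by
  induction hf with
  | viaL g h =>
    obtain ⟨h', rfl⟩ := hp h
    exact ⟨h' ∘ₗ g, rfl⟩
  | viaR g h =>
    obtain ⟨h', rfl⟩ := hp h
    exact ⟨h' ∘ₗ g, rfl⟩
  | add f g _ _ h1 h2 =>
    obtain ⟨a, rfl⟩ := h1
    obtain ⟨b, rfl⟩ := h2
    exact ⟨a + b, LinearMap.comp_add _ _ _⟩

lemma Fac.extend {K L M : ModuleCat.{0} A} {f : K →ₗ[A] M} (hf : Fac Q Q K M f)
    (i : K →ₗ[A] L) (hi : ∀ f : K →ₗ[A] Q, ∃ h : L →ₗ[A] Q, h ∘ₗ i = f) :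
    ∃ h : L →ₗ[A] M, h ∘ₗ i = f := by
  induction hf with
  | viaL g h =>
    obtain ⟨g', rfl⟩ := hi g
    exact ⟨h ∘ₗ g', rfl⟩
  | viaR g h =>
    obtain ⟨g', rfl⟩ := hi g
    exact ⟨h ∘ₗ g', rfl⟩
  | add f g _ _ h1 h2 =>
    obtain ⟨a, rfl⟩ := h1
    obtain ⟨b, rfl⟩ := h2
    exact ⟨a + b, LinearMap.add_comp _ _ _⟩

lemma exists_desc {X1 X2 X3 T : ModuleCat.{0} A} {f : X1 →ₗ[A] X2} {g : X2 →ₗ[A] X3}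
    (hfg : Function.Exact f g) (hg : Function.Surjective g) (u : X2 →ₗ[A] T)
    (hu : u ∘ₗ f = 0) : ∃ v : X3 →ₗ[A] T, v ∘ₗ g = u := by
  have hk : LinearMap.ker g ≤ LinearMap.ker u := by
    intro x hx
    obtain ⟨y, rfl⟩ := (hfg x).1 hx
    exact LinearMap.congr_fun hu y
  refine ⟨(LinearMap.ker g).liftQ u hk ∘ₗ (g.quotKerEquivOfSurjective hg).symm.toLinearMap, ?_⟩
  ext x
  have : (g.quotKerEquivOfSurjective hg).symm (g x) = Submodule.Quotient.mk x := by
    rw [LinearEquiv.symm_apply_eq]; rfl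
  simp [this]

lemma exists_cod {X1 X2 X3 T : ModuleCat.{0} A} {f : X1 →ₗ[A] X2} {g : X2 →ₗ[A] X3}
    (hf : Function.Injective f) (hfg : Function.Exact f g) (u : T →ₗ[A] X2)
    (hu : g ∘ₗ u = 0) : ∃ v : T →ₗ[A] X1, f ∘ₗ v = u := by
  have hk : ∀ t, u t ∈ LinearMap.range f := fun t => (hfg (u t)).1 (LinearMap.congr_fun hu t)
  refine ⟨(LinearEquiv.ofInjective f hf).symm.toLinearMap ∘ₗ u.codRestrict _ hk, ?_⟩
  ext x
  have := LinearEquiv.apply_symm_apply (LinearEquiv.ofInjective f hf) (u.codRestrict _ hk x)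
  exact congrArg Subtype.val this

end FacSec

section Seqs
variable {A : Type} [Ring A] (Q : ModuleCat.{0} A) (n : ℕ)

structure CoSeq where
  K : ℕ → ModuleCat.{0} A
  M : ℕ → ModuleCat.{0} A
  ι : ∀ j, K j →ₗ[A] M j
  π : ∀ j, M j →ₗ[A] K (j+1)
  e0 : A ≃ₗ[A] K 0
  mem : ∀ j, j < n → InAdd A Q (M j)
  inj : ∀ j, j < n → Function.Injective (ι j)
  exact : ∀ j, j < n → Function.Exact (ι j) (π j)
  surj : ∀ j, j < n → Function.Surjective (π j)
  ext : ∀ j, j < n → ∀ f : K j →ₗ[A] Q, ∃ h : M j →ₗ[A] Q, h ∘ₗ ι j = f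

structure ResSeq (D : ModuleCat.{0} A) where
  Y : ℕ → ModuleCat.{0} A
  N : ℕ → ModuleCat.{0} A
  ι : ∀ j, Y (j+1) →ₗ[A] N j
  p : ∀ j, N j →ₗ[A] Y j
  e0 : D ≃ₗ[A] Y 0
  fin : ∀ j, Module.Finite A (Y j)
  mem : ∀ j, InAdd A Q (N j)
  inj : ∀ j, Function.Injective (ι j)
  exact : ∀ j, Function.Exact (ι j) (p j)
  lift : ∀ j, ∀ f : Q →ₗ[A] Y j, ∃ h : Q →ₗ[A] N j, p j ∘ₗ h = f

variable {Q n}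

lemma exists_coSeq (hn : 0 < n) (h : domdimGE A Q (ModuleCat.of A A) n) :
    Nonempty (CoSeq Q n) := by
  obtain h | ⟨M, ι, d, h1, h2, h3, h4, h5, h6, h7⟩ := h
  · omega
  let R : ∀ j, Submodule A (M j) := fun j => match j with
    | 0 => LinearMap.range ι
    | j+1 => LinearMap.range (d j)
  let K : ℕ → ModuleCat.{0} A := fun j => match j with
    | 0 => ModuleCat.of A A
    | j+1 => ModuleCat.of A (M j ⧸ R j)
  have hR : ∀ j, j + 1 < n → R j = LinearMap.ker (d j) := by
    intro j hj
    cases j with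
    | zero => exact (LinearMap.exact_iff.1 (h3 (by omega))).symm
    | succ j => exact (LinearMap.exact_iff.1 (h4 j (by omega))).symm
  classical
  let i : ∀ j, K j →ₗ[A] M j := fun j => match j with
    | 0 => ι
    | j+1 => if h : R j ≤ LinearMap.ker (d j) then (R j).liftQ (d j) h else 0
  have hi : ∀ j, (h : j + 1 < n) → i (j+1) = (R j).liftQ (d j) (hR j h).le := by
    intro j h
    exact dif_pos _
  have hrange : ∀ j, j < n → LinearMap.range (i j) = R j := by
    intro j hj
    cases j with
    | zero => rfl
    | succ j =>
      rw [hi j hj]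
      exact Submodule.range_liftQ _ _ _
  refine ⟨⟨K, M, i, fun j => (R j).mkQ, LinearEquiv.refl A A, fun j hj => h1 j hj, ?_, ?_,
    fun j _ => Submodule.mkQ_surjective _, ?_⟩⟩
  · intro j hj
    cases j with
    | zero => exact h2
    | succ j =>
      rw [hi j hj, ← LinearMap.ker_eq_bot]
      exact Submodule.ker_liftQ_eq_bot _ _ _ (hR j hj).ge
  · intro j hj
    rw [LinearMap.exact_iff, hrange j hj]
    exact Submodule.ker_mkQ _
  · intro j hj f
    cases j with
    | zero => exact h5 f
    | succ j =>
      have key : (f ∘ₗ (R j).mkQ) ∈ Set.range (fun h : M (j+1) →ₗ[A] Q => h ∘ₗ d j) := by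
        cases j with
        | zero =>
          exact h6 (by omega) _ (by
            refine LinearMap.ext fun x => ?_
            exact (congrArg f ((Submodule.Quotient.mk_eq_zero (R 0)).2 ⟨x, rfl⟩)).trans (map_zero f))
        | succ j =>
          exact h7 j (by omega) _ (by
            ext x
            exact (congrArg f ((Submodule.Quotient.mk_eq_zero (R (j+1))).2 ⟨x, rfl⟩)).trans
              (map_zero f))
      obtain ⟨h, hh⟩ := key
      refine ⟨h, ?_⟩
      rw [hi j hj]
      apply LinearMap.ext
      intro x
      obtain ⟨x, rfl⟩ := Submodule.mkQ_surjective (R j) x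
      exact LinearMap.congr_fun hh x

lemma exists_resSeq (k : Type) [Field k] [Algebra k A] [FiniteDimensional k A]
    [Module.Finite A Q] (D : ModuleCat.{0} A) [Module.Finite A D] : Nonempty (ResSeq Q D) := by
  choose r p hp using fun Y : {Y : ModuleCat.{0} A // Module.Finite A Y} =>
    haveI := Y.2
    right_approx k Q Y.1
  have hfin : ∀ Y : {Y : ModuleCat.{0} A // Module.Finite A Y},
      Module.Finite A (LinearMap.ker (p Y)) := by
    intro Y
    have := noeth k (ModuleCat.of A (Fin (r Y) → Q))
    exact Module.IsNoetherian.finite A (LinearMap.ker (p Y))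
  let Y : ℕ → {Y : ModuleCat.{0} A // Module.Finite A Y} := fun j =>
    Nat.rec ⟨D, inferInstance⟩ (fun _ Y => ⟨ModuleCat.of A (LinearMap.ker (p Y)), hfin Y⟩) j
  exact ⟨⟨fun j => (Y j).1, fun j => ModuleCat.of A (Fin (r (Y j)) → Q),
    fun j => (LinearMap.ker (p (Y j))).subtype, fun j => p (Y j), LinearEquiv.refl A D,
    fun j => (Y j).2, fun j => inAdd_pow _, fun j => Submodule.injective_subtype _,
    fun j => LinearMap.exact_subtype_ker_map _, fun j => hp (Y j)⟩⟩

variable {D : ModuleCat.{0} A} (C : CoSeq Q n) (S : ResSeq Q D)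

lemma lemS (hD : Module.Injective A D) (j : ℕ) : ∀ i, i + j + 1 ≤ n → ∀ f : C.K i →ₗ[A] S.Y j,
    ∃ h : C.M i →ₗ[A] S.Y j, h ∘ₗ C.ι i = f := by
  induction j with
  | zero =>
    intro i hi f
    obtain ⟨h, hh⟩ := hD.out (C.ι i) (C.inj i (by omega)) (S.e0.symm.toLinearMap ∘ₗ f)
    refine ⟨S.e0.toLinearMap ∘ₗ h, ?_⟩
    ext x
    simp [hh]
  | succ j ih =>
    intro i hi f
    obtain ⟨F, hF⟩ := ((fac_of_inAdd (S.mem j)).of_id_right (S.ι j ∘ₗ f)).extend (C.ι i)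
      (C.ext i (by omega))
    obtain ⟨v, hv⟩ := exists_desc (C.exact i (by omega)) (C.surj i (by omega)) (S.p j ∘ₗ F) (by
      rw [LinearMap.comp_assoc, hF, ← LinearMap.comp_assoc,
        (S.exact j).linearMap_comp_eq_zero, LinearMap.zero_comp])
    obtain ⟨w, hw⟩ := ih (i+1) (by omega) v
    obtain ⟨l, hl⟩ := ((fac_of_inAdd (C.mem (i+1) (by omega))).of_id_left w).lift (S.p j) (S.lift j)
    obtain ⟨t, ht⟩ := exists_cod (S.inj j) (S.exact j) (F - l ∘ₗ C.ι (i+1) ∘ₗ C.π i) (by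
      rw [LinearMap.comp_sub, ← LinearMap.comp_assoc, hl, ← LinearMap.comp_assoc, hw, hv, sub_self])
    refine ⟨t, ?_⟩
    apply LinearMap.ext
    intro x
    apply S.inj j
    have e1 := LinearMap.congr_fun ht (C.ι i x)
    have e2 := LinearMap.congr_fun hF x
    have e3 := (C.exact i (by omega)).apply_apply_eq_zero x
    simp only [LinearMap.comp_apply, LinearMap.sub_apply] at e1 e2 ⊢
    rw [e1, e2, e3, map_zero, map_zero, sub_zero]

lemma psurj (hD : Module.Injective A D) (C : CoSeq Q n) (j : ℕ) (hj : j + 1 ≤ n) :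
    Function.Surjective (S.p j) := by
  intro y
  let f : C.K 0 →ₗ[A] S.Y j := LinearMap.toSpanSingleton A _ y ∘ₗ C.e0.symm.toLinearMap
  obtain ⟨h, hh⟩ := lemS C S hD j 0 (by omega) f
  obtain ⟨l, hl⟩ := ((fac_of_inAdd (C.mem 0 (by omega))).of_id_left h).lift (S.p j) (S.lift j)
  refine ⟨l (C.ι 0 (C.e0 1)), ?_⟩
  have e1 := LinearMap.congr_fun hl (C.ι 0 (C.e0 1))
  have e2 := LinearMap.congr_fun hh (C.e0 1)
  simp only [LinearMap.comp_apply] at e1 e2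
  rw [e1, e2]
  simp [f]

variable (Q) in
/-- coresolution class -/
def CC (D : ModuleCat.{0} A) : ℕ → ModuleCat.{0} A → Prop
  | 0, X => Fac D D X X LinearMap.id
  | j+1, X => ∃ (I X' : ModuleCat.{0} A) (f : X →ₗ[A] I) (g : I →ₗ[A] X'),
      Function.Injective f ∧ Function.Exact f g ∧ Function.Surjective g ∧ Module.Injective A I ∧
      (∀ q : Q →ₗ[A] X', ∃ h : Q →ₗ[A] I, g ∘ₗ h = q) ∧ CC D j X'

variable (Q) in
/-- resolution class -/
def DD (D : ModuleCat.{0} A) : ℕ → ModuleCat.{0} A → Prop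
  | 0, X => Fac D D X X LinearMap.id
  | j+1, X => ∃ (P X' : ModuleCat.{0} A) (f : X' →ₗ[A] P) (g : P →ₗ[A] X),
      Function.Injective f ∧ Function.Exact f g ∧ Function.Surjective g ∧ Module.Projective A P ∧
      (∀ q : X' →ₗ[A] Q, ∃ h : P →ₗ[A] Q, h ∘ₗ f = q) ∧ DD D j X'

lemma claimR (j : ℕ) : ∀ i, i + j ≤ n → ∀ X, CC Q (S.Y 0) j X → ∀ f : C.K i →ₗ[A] X,
    Fac (S.Y j) Q _ _ f := by
  induction j with
  | zero =>
    intro i _ X hX f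
    exact (hX.of_id_right f).trans .idL .idL
  | succ j ih =>
    rintro i hi X ⟨I, X', a, b, ha, hab, hb, hI, hQ, hX'⟩ f
    obtain ⟨F, hF⟩ := hI.out (C.ι i) (C.inj i (by omega)) (a ∘ₗ f)
    replace hF : F ∘ₗ C.ι i = a ∘ₗ f := LinearMap.ext hF
    obtain ⟨f', hf'⟩ := exists_desc (C.exact i (by omega)) (C.surj i (by omega)) (b ∘ₗ F) (by
      rw [LinearMap.comp_assoc, hF, ← LinearMap.comp_assoc, hab.linearMap_comp_eq_zero,
        LinearMap.zero_comp])
    have hfac := ih (i+1) (by omega) X' hX' f'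
    have key : ∀ g' : C.K (i+1) →ₗ[A] X', Fac (S.Y j) Q _ _ g' →
        ∃ (F' : C.M i →ₗ[A] I) (f1 : C.K i →ₗ[A] X), b ∘ₗ F' = g' ∘ₗ C.π i ∧
          F' ∘ₗ C.ι i = a ∘ₗ f1 ∧ Fac (S.Y (j+1)) Q _ _ f1 := by
      intro g' hg'
      induction hg' with
      | viaL g h =>
        obtain ⟨l, hl⟩ := ((fac_of_inAdd (C.mem i (by omega))).of_id_left (g ∘ₗ C.π i)).lift
          (S.p j) (S.lift j)
        obtain ⟨u, hu⟩ := ((fac_of_inAdd (S.mem j)).of_id_left (h ∘ₗ S.p j)).lift b hQ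
        obtain ⟨t, ht⟩ := exists_cod (S.inj j) (S.exact j) (l ∘ₗ C.ι i) (by
          rw [← LinearMap.comp_assoc, hl, LinearMap.comp_assoc,
            (C.exact i (by omega)).linearMap_comp_eq_zero, LinearMap.comp_zero])
        obtain ⟨v, hv⟩ := exists_cod ha hab (u ∘ₗ S.ι j) (by
          rw [← LinearMap.comp_assoc, hu, LinearMap.comp_assoc,
            (S.exact j).linearMap_comp_eq_zero, LinearMap.comp_zero])
        refine ⟨u ∘ₗ l, v ∘ₗ t, ?_, ?_, .viaL _ _⟩
        · rw [← LinearMap.comp_assoc, hu, LinearMap.comp_assoc, hl, LinearMap.comp_assoc]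
        · rw [← LinearMap.comp_assoc, hv, LinearMap.comp_assoc, LinearMap.comp_assoc, ht]
      | viaR g h =>
        obtain ⟨h', rfl⟩ := hQ h
        refine ⟨h' ∘ₗ g ∘ₗ C.π i, 0, ?_, ?_, .zero⟩
        · simp only [LinearMap.comp_assoc]
        · simp only [LinearMap.comp_assoc]
          rw [(C.exact i (by omega)).linearMap_comp_eq_zero]; simp
      | add f g _ _ h1 h2 =>
        obtain ⟨F1, f1, h11, h12, h13⟩ := h1
        obtain ⟨F2, f2, h21, h22, h23⟩ := h2
        refine ⟨F1 + F2, f1 + f2, ?_, ?_, .add _ _ h13 h23⟩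
        · rw [LinearMap.comp_add, LinearMap.add_comp, h11, h21]
        · rw [LinearMap.comp_add, LinearMap.add_comp, h12, h22]
    obtain ⟨F', f1, h1, h2, h3⟩ := key f' hfac
    obtain ⟨w, hw⟩ := exists_cod ha hab (F - F') (by
      rw [LinearMap.comp_sub, h1, hf', sub_self])
    have : f = w ∘ₗ C.ι i + f1 := by
      apply LinearMap.ext
      intro x
      apply ha
      have e1 := LinearMap.congr_fun hw (C.ι i x)
      have e2 := LinearMap.congr_fun h2 x
      have e3 := LinearMap.congr_fun hF x
      simp only [LinearMap.comp_apply, LinearMap.sub_apply, LinearMap.add_apply, map_add]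
        at e1 e2 e3 ⊢
      rw [e1, ← e2, ← e3]; simp
    rw [this]
    refine .add _ _ ?_ h3
    exact (((fac_of_inAdd (C.mem i (by omega))).of_id_left w).comp_right (C.ι i)).trans .idR .idR

lemma claimR' (hp : ∀ j, j < n → Function.Surjective (S.p j)) (j : ℕ) : ∀ i, i + j ≤ n →
    ∀ X, DD Q (C.K 0) j X → ∀ f : X →ₗ[A] S.Y i, Fac (C.K j) Q _ _ f := by
  induction j with
  | zero =>
    intro i _ X hX f
    exact (hX.of_id_left f).trans .idL .idL
  | succ j ih =>
    rintro i hi X ⟨P, X', a, b, ha, hab, hb, hP, hQ, hX'⟩ f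
    obtain ⟨F, hF⟩ := Module.projective_lifting_property (S.p i) (f ∘ₗ b) (hp i (by omega))
    obtain ⟨f', hf'⟩ := exists_cod (S.inj i) (S.exact i) (F ∘ₗ a) (by
      rw [← LinearMap.comp_assoc, hF, LinearMap.comp_assoc, hab.linearMap_comp_eq_zero,
        LinearMap.comp_zero])
    have hfac := ih (i+1) (by omega) X' hX' f'
    have key : ∀ g' : X' →ₗ[A] S.Y (i+1), Fac (C.K j) Q _ _ g' →
        ∃ (F' : P →ₗ[A] S.N i) (f1 : X →ₗ[A] S.Y i), F' ∘ₗ a = S.ι i ∘ₗ g' ∧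
          S.p i ∘ₗ F' = f1 ∘ₗ b ∧ Fac (C.K (j+1)) Q _ _ f1 := by
      intro g' hg'
      induction hg' with
      | viaL g h =>
        obtain ⟨u, hu⟩ := ((fac_of_inAdd (C.mem j (by omega))).of_id_right (C.ι j ∘ₗ g)).extend
          a hQ
        obtain ⟨l, hl⟩ := ((fac_of_inAdd (S.mem i)).of_id_right (S.ι i ∘ₗ h)).extend (C.ι j)
          (C.ext j (by omega))
        obtain ⟨t, ht⟩ := exists_desc hab hb (C.π j ∘ₗ u) (by
          rw [LinearMap.comp_assoc, hu, ← LinearMap.comp_assoc,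
            (C.exact j (by omega)).linearMap_comp_eq_zero, LinearMap.zero_comp])
        obtain ⟨v, hv⟩ := exists_desc (C.exact j (by omega)) (C.surj j (by omega)) (S.p i ∘ₗ l) (by
          rw [LinearMap.comp_assoc, hl, ← LinearMap.comp_assoc,
            (S.exact i).linearMap_comp_eq_zero, LinearMap.zero_comp])
        refine ⟨l ∘ₗ u, v ∘ₗ t, ?_, ?_, .viaL _ _⟩
        · rw [LinearMap.comp_assoc, hu, ← LinearMap.comp_assoc, hl, LinearMap.comp_assoc]
        · rw [← LinearMap.comp_assoc, ← hv, LinearMap.comp_assoc, LinearMap.comp_assoc, ht]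
      | viaR g h =>
        obtain ⟨g', rfl⟩ := hQ g
        refine ⟨S.ι i ∘ₗ h ∘ₗ g', 0, ?_, ?_, .zero⟩
        · simp only [LinearMap.comp_assoc]
        · rw [← LinearMap.comp_assoc, (S.exact i).linearMap_comp_eq_zero]; simp
      | add f g _ _ h1 h2 =>
        obtain ⟨F1, f1, h11, h12, h13⟩ := h1
        obtain ⟨F2, f2, h21, h22, h23⟩ := h2
        refine ⟨F1 + F2, f1 + f2, ?_, ?_, .add _ _ h13 h23⟩
        · rw [LinearMap.comp_add, LinearMap.add_comp, h11, h21]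
        · rw [LinearMap.comp_add, LinearMap.add_comp, h12, h22]
    obtain ⟨F', f1, h1, h2, h3⟩ := key f' hfac
    obtain ⟨w, hw⟩ := exists_desc hab hb (F - F') (by
      rw [LinearMap.sub_comp, h1, hf', sub_self])
    have : f = S.p i ∘ₗ w + f1 := by
      apply LinearMap.ext
      intro x
      obtain ⟨x, rfl⟩ := hb x
      have e1 := congrArg (S.p i) (LinearMap.congr_fun hw x)
      have e2 := LinearMap.congr_fun h2 x
      have e3 := LinearMap.congr_fun hF x
      simp only [LinearMap.comp_apply, LinearMap.sub_apply, LinearMap.add_apply, map_sub]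
        at e1 e2 e3 ⊢
      rw [e1, ← e2, ← e3]; simp
    rw [this]
    refine .add _ _ ?_ h3
    exact (((fac_of_inAdd (S.mem i)).of_id_right w).comp_left (S.p i)).trans .idR .idR

end Seqs
end PaperAux
end
end Part4

section Part5
open MulOpposite
open Paper CategoryTheory Abelian

noncomputable section
namespace PaperAux
section Dual
variable (k : Type) [Field k] {R S : Type} [Ring R] [Algebra k R] [Ring S]
  (σ : S ≃+* Rᵐᵒᵖ)

/-- `k`-dual of an `R`-module, as a module over `S ≅ Rᵐᵒᵖ`. -/
def DMt (_σ : S ≃+* Rᵐᵒᵖ) (X : ModuleCat.{0} R) : Type := X →ₗ[k] k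

instance (X : ModuleCat.{0} R) : AddCommGroup (DMt k σ X) :=
  inferInstanceAs (AddCommGroup (X →ₗ[k] k))

variable {k σ}
/-- view as a linear map -/
def DMt.ev {X : ModuleCat.{0} R} (φ : DMt k σ X) : X →ₗ[k] k := φ

lemma DMt.ext {X : ModuleCat.{0} R} {φ ψ : DMt k σ X} (h : ∀ b, φ.ev b = ψ.ev b) : φ = ψ :=
  LinearMap.ext h

instance (X : ModuleCat.{0} R) : Module S (DMt k σ X) where
  smul b φ := φ.ev ∘ₗ (DistribMulAction.toLinearMap k X (σ b).unop)
  one_smul φ := DMt.ext fun x => by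
    show φ.ev ((σ 1).unop • x) = φ.ev x
    rw [map_one, MulOpposite.unop_one, one_smul]
  mul_smul b c φ := DMt.ext fun x => by
    show φ.ev ((σ (b * c)).unop • x) = φ.ev ((σ c).unop • (σ b).unop • x)
    rw [map_mul, unop_mul, mul_smul]
  smul_zero _ := rfl
  smul_add _ _ _ := rfl
  add_smul b c φ := DMt.ext fun x => by
    show φ.ev ((σ (b + c)).unop • x) = φ.ev ((σ b).unop • x) + φ.ev ((σ c).unop • x)
    rw [map_add, MulOpposite.unop_add, add_smul, map_add]
  zero_smul φ := DMt.ext fun x => by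
    show φ.ev ((σ 0).unop • x) = 0
    rw [map_zero, MulOpposite.unop_zero, zero_smul, map_zero]

@[simp] lemma DMt.smul_ev {X : ModuleCat.{0} R} (b : S) (φ : DMt k σ X) (x : X) :
    (b • φ).ev x = φ.ev ((σ b).unop • x) := rfl
@[simp] lemma DMt.add_ev {X : ModuleCat.{0} R} (φ ψ : DMt k σ X) (x : X) :
    (φ + ψ).ev x = φ.ev x + ψ.ev x := rfl
@[simp] lemma DMt.zero_ev {X : ModuleCat.{0} R} (x : X) : (0 : DMt k σ X).ev x = 0 := rfl

variable (k σ) in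
/-- bundled -/
abbrev DM (X : ModuleCat.{0} R) : ModuleCat.{0} S := ModuleCat.of S (DMt k σ X)

variable (k σ) in
/-- functoriality -/
def dmap {X Y : ModuleCat.{0} R} (f : X →ₗ[R] Y) : DM k σ Y →ₗ[S] DM k σ X where
  toFun (φ : DMt k σ Y) := show DMt k σ X from (DMt.ev φ) ∘ₗ f.restrictScalars k
  map_add' _ _ := rfl
  map_smul' b (φ : DMt k σ Y) := DMt.ext fun x => by
    show φ.ev ((σ b).unop • f x) = φ.ev (f ((σ b).unop • x))
    rw [f.map_smul]

@[simp] lemma dmap_ev {X Y : ModuleCat.{0} R} (f : X →ₗ[R] Y) (φ : DMt k σ Y) (x : X) :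
    DMt.ev (σ := σ) (X := X) (dmap k σ f φ) x = φ.ev (f x) := rfl

lemma dmap_comp {X Y Z : ModuleCat.{0} R} (f : X →ₗ[R] Y) (g : Y →ₗ[R] Z) :
    dmap k σ (g ∘ₗ f) = dmap k σ f ∘ₗ dmap k σ g := rfl

lemma dmap_id {X : ModuleCat.{0} R} :
    dmap k σ (LinearMap.id : X →ₗ[R] X) = LinearMap.id := rfl

lemma dmap_add {X Y : ModuleCat.{0} R} (f g : X →ₗ[R] Y) :
    dmap k σ (f + g) = dmap k σ f + dmap k σ g :=
  LinearMap.ext fun (φ : DMt k σ Y) => DMt.ext (k := k) (σ := σ) (X := X)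
    fun x => map_add (DMt.ev φ) (f x) (g x)

lemma Fac.dmap {Y Q X Z : ModuleCat.{0} R} {f : X →ₗ[R] Z} (h : Fac Y Q X Z f) :
    Fac (DM k σ Y) (DM k σ Q) (DM k σ Z) (DM k σ X) (dmap k σ f) := by
  induction h with
  | viaL g h => rw [dmap_comp]; exact .viaL _ _
  | viaR g h => rw [dmap_comp]; exact .viaR _ _
  | add f g _ _ h1 h2 => rw [dmap_add]; exact .add _ _ h1 h2

lemma dmap_surj {X Y : ModuleCat.{0} R} (f : X →ₗ[R] Y) (hf : Function.Injective f) :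
    Function.Surjective (dmap k σ f) := fun (φ : DMt k σ X) => by
  obtain ⟨ψ, hψ⟩ := extend_k (f.restrictScalars k) hf (DMt.ev φ)
  exact ⟨ψ, hψ⟩

lemma dmap_inj {X Y : ModuleCat.{0} R} (f : X →ₗ[R] Y) (hf : Function.Surjective f) :
    Function.Injective (dmap k σ f) := fun φ ψ h => DMt.ext fun y => by
  obtain ⟨x, rfl⟩ := hf y
  exact congrArg (fun z : DMt k σ X => DMt.ev z x) h

lemma dmap_exact {X Y Z : ModuleCat.{0} R} (f : X →ₗ[R] Y) (g : Y →ₗ[R] Z)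
    (hfg : Function.Exact f g) (hg : Function.Surjective g) :
    Function.Exact (dmap k σ g) (dmap k σ f) := by
  intro (φ : DMt k σ Y)
  constructor
  · intro h
    have hk : LinearMap.ker (g.restrictScalars k) ≤ LinearMap.ker (DMt.ev φ) := by
      intro y hy
      obtain ⟨x, rfl⟩ := (hfg y).1 hy
      exact congrArg (fun z : DMt k σ X => DMt.ev z x) h
    refine ⟨(LinearMap.ker (g.restrictScalars k)).liftQ (DMt.ev φ) hk ∘ₗ
      ((g.restrictScalars k).quotKerEquivOfSurjective hg).symm.toLinearMap, ?_⟩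
    refine DMt.ext (k := k) (σ := σ) (X := Y) fun y => ?_
    have : ((g.restrictScalars k).quotKerEquivOfSurjective hg).symm (g y)
        = Submodule.Quotient.mk y := by
      rw [LinearEquiv.symm_apply_eq]; rfl
    show (LinearMap.ker (g.restrictScalars k)).liftQ (DMt.ev φ) hk
      (((g.restrictScalars k).quotKerEquivOfSurjective hg).symm (g y)) = _
    rw [this]; rfl
  · rintro ⟨(ψ : DMt k σ Z), rfl⟩
    refine DMt.ext (k := k) (σ := σ) (X := X) fun x => ?_
    rw [dmap_ev, dmap_ev, hfg.apply_apply_eq_zero, map_zero]; rfl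

variable [FiniteDimensional k R]

variable (k σ) in
/-- the dual of the cogenerator is the regular module -/
def ddMap (I : ModuleCat.{0} R) (e : I ≃ₗ[R] DBt k R) : S →ₗ[S] DMt k σ I where
  toFun s := show I →ₗ[k] k from
    { toFun := fun φ => DBt.ev (e φ) (σ s).unop
      map_add' := fun φ ψ => by rw [map_add]; rfl
      map_smul' := fun c φ => by
        have : e (c • φ) = algebraMap k R c • e φ := e.map_smul _ _
        rw [this, DBt.smul_ev, ← Algebra.commutes, ← Algebra.smul_def, map_smul]; rfl }
  map_add' s t := DMt.ext fun φ => by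
    show DBt.ev (e φ) (σ (s + t)).unop = DBt.ev (e φ) (σ s).unop + DBt.ev (e φ) (σ t).unop
    rw [map_add, MulOpposite.unop_add, map_add]
  map_smul' s t := DMt.ext fun φ => by
    show DBt.ev (e φ) (σ (s * t)).unop = DBt.ev (e ((σ s).unop • φ)) (σ t).unop
    rw [map_mul, unop_mul, map_smul]; rfl

lemma ddMap_bij (I : ModuleCat.{0} R) (e : I ≃ₗ[R] DBt k R) :
    Function.Bijective (ddMap k σ I e) := by
  constructor
  · intro s t h
    apply σ.injective
    apply unop_injective
    apply (Module.evalEquiv k R).injective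
    ext φ
    have h2 : DBt.ev (e (e.symm φ)) (σ s).unop = DBt.ev (e (e.symm φ)) (σ t).unop :=
      congrArg (fun z : DMt k σ I => DMt.ev z (e.symm φ)) h
    have h3 := e.apply_symm_apply (show DBt k R from φ)
    have h4 : ∀ r, DBt.ev (e (e.symm φ)) r = φ r := fun r => congrArg (fun z => DBt.ev z r) h3
    exact ((h4 _).symm.trans h2).trans (h4 _)
  · intro ψ
    let ψ' : (R →ₗ[k] k) →ₗ[k] k :=
      { toFun := fun φ => DMt.ev ψ (e.symm φ)
        map_add' := fun φ φ' =>
          Eq.trans (congrArg (DMt.ev ψ) (map_add e.symm (φ : DBt k R) φ'))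
            (map_add (DMt.ev ψ) _ _)
        map_smul' := fun c φ => by
          have h := map_smul (DMt.ev ψ) c (e.symm φ)
          refine Eq.trans (congrArg (DMt.ev ψ) ?_) h
          apply e.injective
          have : e (c • e.symm φ) = algebraMap k R c • e (e.symm φ) := e.map_smul _ _
          rw [this]
          have h3 := e.apply_symm_apply (show DBt k R from φ)
          refine (e.apply_symm_apply (show DBt k R from c • φ)).trans
            (Eq.trans ?_ (congrArg (fun z => algebraMap k R c • z) h3.symm))
          refine DBt.ext fun x => ?_
          show c • φ x = φ (x * algebraMap k R c)
          rw [← Algebra.commutes, ← Algebra.smul_def, φ.map_smul] }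
    refine ⟨σ.symm (op ((Module.evalEquiv k R).symm ψ')), DMt.ext fun φ => ?_⟩
    show DBt.ev (e φ) (σ (σ.symm (op ((Module.evalEquiv k R).symm ψ')))).unop = _
    rw [RingEquiv.apply_symm_apply, unop_op]
    have := LinearMap.congr_fun ((Module.evalEquiv k R).apply_symm_apply ψ') (e φ)
    have h2 : DMt.ev ψ (e.symm (e φ)) = DMt.ev ψ φ := by rw [e.symm_apply_apply]
    exact this.trans h2

variable (k σ) in
lemma fac_ddual (P : ModuleCat.{0} S) :
    Fac (ModuleCat.of S S) P (DM k σ (DB k R)) (DM k σ (DB k R)) LinearMap.id := by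
  let e := LinearEquiv.ofBijective (ddMap k σ (DB k R) (LinearEquiv.refl R _)) (ddMap_bij _ _)
  have : (LinearMap.id : DM k σ (DB k R) →ₗ[S] DM k σ (DB k R)) =
      e.toLinearMap ∘ₗ e.symm.toLinearMap := by ext x; simp
  rw [this]
  exact .viaL (Y := ModuleCat.of S S) _ _

/-- an injective f.g. module is in add of the cogenerator -/
lemma fac_of_injective {X : ModuleCat.{0} R} (hX : Module.Injective R X) {r : ℕ}
    (i : X →ₗ[R] (Fin r → DB k R)) (hi : Function.Injective i) :
    Fac (DB k R) (DB k R) X X LinearMap.id := by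
  obtain ⟨t, ht⟩ := hX.out i hi LinearMap.id
  exact fac_of_inAdd ⟨r, i, t, LinearMap.ext ht⟩

lemma proj_of_fac {P : ModuleCat.{0} S} (h : Fac (ModuleCat.of S S) (ModuleCat.of S S) P P
    LinearMap.id) : Module.Projective S P := by
  obtain ⟨r, s, t, h⟩ := inAdd_of_fac' h
  have : Module.Projective S (Fin r → (ModuleCat.of S S)) :=
    inferInstanceAs (Module.Projective S (Fin r → S))
  exact Module.Projective.of_split s t h

lemma fac_of_proj {P : ModuleCat.{0} S} (h : Module.Projective S P) [Module.Finite S P] :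
    Fac (ModuleCat.of S S) (ModuleCat.of S S) P P LinearMap.id := by
  obtain ⟨r, f, hf⟩ := Module.Finite.exists_fin' S P
  obtain ⟨s, hs⟩ := Module.projective_lifting_property f LinearMap.id hf
  exact fac_of_inAdd ⟨r, s, f, hs⟩

lemma coker_finite {B : Type} [Ring B] {X Y : ModuleCat.{0} B} [Module.Finite B Y]
    (f : X →ₗ[B] Y) : Module.Finite B (ModuleCat.of B (Y ⧸ LinearMap.range f)) :=
  inferInstanceAs (Module.Finite B (Y ⧸ LinearMap.range f))

variable (k σ) in
lemma pd_dual (j : ℕ) : ∀ X : ModuleCat.{0} R, Module.Finite R X →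
    HasInjectiveDimensionLT X (j+1) → HasProjectiveDimensionLT (DM k σ X) (j+1) := by
  have proj : ∀ X : ModuleCat.{0} R, Fac (DB k R) (DB k R) X X LinearMap.id →
      Projective (DM k σ X) := fun X h =>
    (IsProjective.iff_projective _).1
      (proj_of_fac ((dmap_id (k := k) (σ := σ) (X := X) ▸ h.dmap).trans
        (fac_ddual k σ _) (fac_ddual k σ _)))
  induction j with
  | zero =>
    intro X _ hX
    have : Injective X := injective_iff_hasInjectiveDimensionLT_one.2 hX
    obtain ⟨r, i, hi⟩ := embed k X
    have := proj X (fac_of_injective ((Module.injective_iff_injective_object _ _).2 this) i hi)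
    infer_instance
  | succ j ih =>
    intro X _ hX
    obtain ⟨r, i, hi⟩ := embed k X
    let I : ModuleCat.{0} R := ModuleCat.of R (Fin r → DB k R)
    let i' : X →ₗ[R] I := i
    have hI : Module.Injective R I := inj_pow (inj_D k R) r
    have hI' : Injective I := (Module.injective_iff_injective_object _ _).1 hI
    have hE := LinearMap.exact_map_mkQ_range i'
    have s := sexact (Z := ModuleCat.of R (I ⧸ LinearMap.range i')) i'
      (LinearMap.range i').mkQ hi hE (Submodule.mkQ_surjective _)
    have hf : Module.Finite R I := inferInstanceAs (Module.Finite R (Fin r → DBt k R))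
    have h1 := ih (ModuleCat.of R (I ⧸ LinearMap.range i')) (coker_finite i')
      (s.hasInjectiveDimensionLT_X₃ (j+1) (hasInjectiveDimensionLT_of_ge I 1 _ (by omega)) hX)
    have s' := sexact (dmap k σ (Y := ModuleCat.of R (I ⧸ LinearMap.range i'))
      (LinearMap.range i').mkQ) (dmap k σ i')
      (dmap_inj _ (Submodule.mkQ_surjective _)) (dmap_exact _ _ hE (Submodule.mkQ_surjective _))
      (dmap_surj _ hi)
    have := proj I (fac_of_inAdd (inAdd_pow r))
    exact s'.hasProjectiveDimensionLT_X₃ (j+1) h1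
      (hasProjectiveDimensionLT_of_ge (DM k σ I) 1 _ (by omega))

end Dual

section Main1
variable (k : Type) [Field k] {A : Type} [Ring A] [Algebra k A] [FiniteDimensional k A]

lemma cc_of_ev (Q : ModuleCat.{0} A) (D : ModuleCat.{0} A) (e : DB k A ≃ₗ[A] D) (j : ℕ) :
    ∀ X : ModuleCat.{0} A,
    Module.Finite A X → HasInjectiveDimensionLT X (j+1) → (∀ i, 1 ≤ i → EV Q X i) →
    CC Q D j X := by
  induction j with
  | zero =>
    intro X _ hX _
    have : Injective X := injective_iff_hasInjectiveDimensionLT_one.2 hX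
    obtain ⟨r, i, hi⟩ := embed k X
    have h := fac_of_injective ((Module.injective_iff_injective_object _ _).2 this) i hi
    have h2 : Fac D D (DB k A) (DB k A) LinearMap.id := by
      have : (LinearMap.id : DB k A →ₗ[A] DB k A) = e.symm.toLinearMap ∘ₗ e.toLinearMap := by
        ext x; simp
      rw [this]; exact .viaL _ _
    exact h.trans h2 h2
  | succ j ih =>
    intro X _ hX hev
    obtain ⟨r, i, hi⟩ := embed k X
    let I : ModuleCat.{0} A := ModuleCat.of A (Fin r → DB k A)
    let i' : X →ₗ[A] I := i
    have hI : Module.Injective A I := inj_pow (inj_D k A) r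
    have hI' : Injective I := (Module.injective_iff_injective_object _ _).1 hI
    have hE := LinearMap.exact_map_mkQ_range i'
    have s := sexact (Z := ModuleCat.of A (I ⧸ LinearMap.range i')) i'
      (LinearMap.range i').mkQ hi hE (Submodule.mkQ_surjective _)
    have hf : Module.Finite A I := inferInstanceAs (Module.Finite A (Fin r → DBt k A))
    refine ⟨I, ModuleCat.of A (I ⧸ LinearMap.range i'), i', (LinearMap.range i').mkQ, hi, hE,
      Submodule.mkQ_surjective _, hI, ?_, ih _ (coker_finite i')
      (s.hasInjectiveDimensionLT_X₃ (j+1) (hasInjectiveDimensionLT_of_ge I 1 _ (by omega)) hX) ?_⟩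
    · exact lift_of_ev (X3 := ModuleCat.of A (I ⧸ LinearMap.range i')) i' (LinearMap.range i').mkQ
        hi hE (Submodule.mkQ_surjective _) (hev 1 le_rfl)
    · intro l hl
      refine ev_cov3 (X3 := ModuleCat.of A (I ⧸ LinearMap.range i')) i' (LinearMap.range i').mkQ
        hi hE (Submodule.mkQ_surjective _) ?_ (hev (l+1) (by omega))
      have : HasInjectiveDimensionLT I 1 := inferInstance
      exact HasInjectiveDimensionLT.subsingleton I 1 l hl Q

include k in
lemma dd_of_ev (Q : ModuleCat.{0} A) (D : ModuleCat.{0} A) (e : A ≃ₗ[A] D) (j : ℕ) :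
    ∀ X : ModuleCat.{0} A,
    Module.Finite A X → HasProjectiveDimensionLT X (j+1) → (∀ i, 1 ≤ i → EV X Q i) →
    DD Q D j X := by
  induction j with
  | zero =>
    intro X _ hX _
    have : Projective X := projective_iff_hasProjectiveDimensionLT_one.2 hX
    have h := fac_of_proj ((IsProjective.iff_projective _).2 this)
    have h2 : Fac D D (ModuleCat.of A A) (ModuleCat.of A A) LinearMap.id := by
      have : (LinearMap.id : A →ₗ[A] A) = e.symm.toLinearMap ∘ₗ e.toLinearMap := by
        ext; simp
      rw [this]; exact .viaL (X := ModuleCat.of A A) (Z := ModuleCat.of A A) _ _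
    exact h.trans h2 h2
  | succ j ih =>
    intro X _ hX hev
    obtain ⟨r, p, hp⟩ := Module.Finite.exists_fin' A X
    let P : ModuleCat.{0} A := ModuleCat.of A (Fin r → A)
    let p' : P →ₗ[A] X := p
    have hP : Module.Projective A P := inferInstanceAs (Module.Projective A (Fin r → A))
    have hP' : Projective P := (IsProjective.iff_projective _).1 hP
    have hE := LinearMap.exact_subtype_ker_map p'
    have s := sexact (X := ModuleCat.of A (LinearMap.ker p')) (LinearMap.ker p').subtype p'
      (Submodule.injective_subtype _) hE hp
    have hf : Module.Finite A P := inferInstanceAs (Module.Finite A (Fin r → A))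
    have := noeth k P
    have hf2 : Module.Finite A (ModuleCat.of A (LinearMap.ker p')) :=
      Module.IsNoetherian.finite A (LinearMap.ker p')
    refine ⟨P, ModuleCat.of A (LinearMap.ker p'), (LinearMap.ker p').subtype, p',
      Submodule.injective_subtype _, hE, hp, hP, ?_, ih _ hf2
      (s.hasProjectiveDimensionLT_X₁ (j+1) (hasProjectiveDimensionLT_of_ge P 1 _ (by omega)) hX) ?_⟩
    · exact extend_of_ev (X1 := ModuleCat.of A (LinearMap.ker p')) (LinearMap.ker p').subtype p'
        (Submodule.injective_subtype _) hE hp (hev 1 le_rfl)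
    · intro l hl
      refine ev_con1 (X1 := ModuleCat.of A (LinearMap.ker p')) (LinearMap.ker p').subtype p'
        (Submodule.injective_subtype _) hE hp ?_ (hev (l+1) (by omega))
      have : HasProjectiveDimensionLT P 1 := inferInstance
      exact HasProjectiveDimensionLT.subsingleton P 1 l hl Q

lemma id_add {Q M : ModuleCat.{0} A} {m : ℕ} (h : InAdd A Q M) (hQ : HasInjectiveDimensionLT Q m) :
    HasInjectiveDimensionLT M m :=
  HasInjectiveDimensionLT.mk fun i hi Y e =>
    (ev_add_right (X := Y) (i := i) h (HasInjectiveDimensionLT.subsingleton Q m i hi Y)).elim _ _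

lemma pd_add {Q M : ModuleCat.{0} A} {m : ℕ} (h : InAdd A Q M) (hQ : HasProjectiveDimensionLT Q m) :
    HasProjectiveDimensionLT M m :=
  HasProjectiveDimensionLT.mk fun i hi Y e =>
    (ev_add_left (X := Y) (i := i) h (HasProjectiveDimensionLT.subsingleton Q m i hi Y)).elim _ _

lemma finite_of_inAdd {Q M : ModuleCat.{0} A} [Module.Finite A Q] (h : InAdd A Q M) :
    Module.Finite A M := by
  obtain ⟨r, s, t, h⟩ := h
  exact Module.Finite.of_surjective t fun x => ⟨s x, LinearMap.congr_fun h x⟩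

/-- dual of the regular right module -/
def dualReg (I : ModuleCat.{0} Aᵐᵒᵖ) (e : I ≃ₗ[Aᵐᵒᵖ] Aᵐᵒᵖ) :
    DMt k (RingEquiv.opOp A) I ≃ₗ[A] DBt k A where
  toFun φ := show A →ₗ[k] k from
    { toFun := fun a => DMt.ev φ (e.symm (op a))
      map_add' := fun a b => by rw [MulOpposite.op_add, map_add, map_add]
      map_smul' := fun c a => by
        refine Eq.trans (congrArg (DMt.ev φ) ?_) (map_smul (DMt.ev φ) c (e.symm (op a)))
        have : c • (e.symm (op a)) = op (algebraMap k A c) • (e.symm (op a)) := rfl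
        rw [this, ← map_smul, smul_eq_mul, ← op_mul, ← Algebra.commutes, Algebra.smul_def] }
  invFun φ := show I →ₗ[k] k from
    { toFun := fun x => DBt.ev φ (unop (e x))
      map_add' := fun a b => by rw [map_add, MulOpposite.unop_add, map_add]
      map_smul' := fun c x => by
        refine Eq.trans (congrArg (DBt.ev φ) ?_) (map_smul (DBt.ev φ) c (unop (e x)))
        have : c • x = op (algebraMap k A c) • x := rfl
        rw [this, map_smul, smul_eq_mul, unop_mul, unop_op, ← Algebra.commutes, Algebra.smul_def] }
  left_inv φ := DMt.ext fun x => by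
    show DMt.ev φ (e.symm (op (unop (e x)))) = DMt.ev φ x
    rw [op_unop, e.symm_apply_apply]
  right_inv φ := DBt.ext fun x => by
    show DBt.ev φ (unop (e (e.symm (op x)))) = DBt.ev φ x
    rw [e.apply_symm_apply, unop_op]
  map_add' _ _ := rfl
  map_smul' b φ := DBt.ext fun x => by
    show DMt.ev φ (op b • e.symm (op x)) = DMt.ev φ (e.symm (op (x * b)))
    rw [← map_smul, smul_eq_mul, op_mul]

lemma pd_DB {n : ℕ} (h : idLE Aᵐᵒᵖ (ModuleCat.of Aᵐᵒᵖ Aᵐᵒᵖ) n) :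
    HasProjectiveDimensionLT (DB k A) (n+1) := by
  have hfd : FiniteDimensional k Aᵐᵒᵖ := inferInstance
  have h1 := pd_dual k (RingEquiv.opOp A) n _ (inferInstanceAs (Module.Finite Aᵐᵒᵖ Aᵐᵒᵖ))
    (hasID_of_idLE h)
  let e := dualReg k (ModuleCat.of Aᵐᵒᵖ Aᵐᵒᵖ) (LinearEquiv.refl _ _)
  exact hasProjectiveDimensionLT_of_iso
    (X := DM k (RingEquiv.opOp A) (ModuleCat.of Aᵐᵒᵖ Aᵐᵒᵖ)) e.toModuleIso (n+1)

/-- the A-side conclusion -/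
theorem main1 (Q : ModuleCat.{0} A) [Module.Finite A Q] (n d : ℕ)
    (hpair : IsRelAGPair A Q n) (hpd : pdLE A Q d) (hid : idLE A Q (n - d))
    (hdn : d ≤ n - 1) (hd2 : 2 ≤ d) :
    ∃ (C : CoSeq Q n) (S : ResSeq Q (DB k A)),
      (∀ j, j < n → Function.Surjective (S.p j)) ∧
      Fac (S.Y (n-d)) Q (C.K d) (C.K d) LinearMap.id ∧
      Fac (C.K d) Q (S.Y (n-d)) (S.Y (n-d)) LinearMap.id := by
  obtain ⟨hA, hAop, hso, hdom⟩ := hpair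
  obtain ⟨C⟩ := exists_coSeq (by omega) hdom
  obtain ⟨S⟩ := exists_resSeq k (Q := Q) (DB k A)
  have hp : ∀ j, j < n → Function.Surjective (S.p j) := fun j hj =>
    psurj S (inj_D k A) C j hj
  have hQQ := ev_of_selfOrth hpd hso
  have hPQ := hasPD_of_pdLE hpd
  have hIQ := hasID_of_idLE hid
  have hIA := hasID_of_idLE hA
  have hK0 : HasInjectiveDimensionLT (C.K 0) (n+1) :=
    hasInjectiveDimensionLT_of_iso (X := ModuleCat.of A A) C.e0.toModuleIso (n+1)
  have hY0 : HasProjectiveDimensionLT (S.Y 0) (n+1) :=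
    have := pd_DB k hAop
    hasProjectiveDimensionLT_of_iso S.e0.toModuleIso (n+1)
  have evK : ∀ j, j ≤ n → ∀ i, 1 ≤ i → d < i + j → EV Q (C.K j) i := by
    intro j
    induction j with
    | zero =>
      intro _ i hi hij
      exact HasProjectiveDimensionLT.subsingleton Q (d+1) i (by omega) _
    | succ j ih =>
      intro hj i hi hij
      exact ev_cov3 _ _ (C.inj j hj) (C.exact j hj) (C.surj j hj)
        (ev_add_right (C.mem j hj) (hQQ i hi)) (ih (by omega) (i+1) (by omega) (by omega))
  have idK : ∀ j, j ≤ d → HasInjectiveDimensionLT (C.K j) (n - j + 1) := by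
    intro j
    induction j with
    | zero => intro _; exact hK0
    | succ j ih =>
      intro hj
      have hjn : j < n := by omega
      have h1 := ih (by omega)
      have s := sexact _ _ (C.inj j hjn) (C.exact j hjn) (C.surj j hjn)
      have h2 := id_add (C.mem j hjn) hIQ
      exact s.hasInjectiveDimensionLT_X₃ _
        (hasInjectiveDimensionLT_of_ge (C.M j) (n - d + 1) _ (by omega))
        (hasInjectiveDimensionLT_of_ge (C.K j) (n - j + 1) _ (by omega))
  have finK : ∀ j, j ≤ n → Module.Finite A (C.K j) := by
    intro j hj
    cases j with
    | zero => exact Module.Finite.equiv C.e0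
    | succ j =>
      have := finite_of_inAdd (C.mem j hj)
      exact Module.Finite.of_surjective (C.π j) (C.surj j hj)
  have evY : ∀ j, j ≤ n → ∀ i, 1 ≤ i → n - d < i + j → EV (S.Y j) Q i := by
    intro j
    induction j with
    | zero =>
      intro _ i hi hij
      exact HasInjectiveDimensionLT.subsingleton Q (n-d+1) i (by omega) _
    | succ j ih =>
      intro hj i hi hij
      exact ev_con1 _ _ (S.inj j) (S.exact j) (hp j hj)
        (ev_add_left (S.mem j) (hQQ i hi)) (ih (by omega) (i+1) (by omega) (by omega))
  have pdY : ∀ j, j ≤ n - d → HasProjectiveDimensionLT (S.Y j) (n - j + 1) := by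
    intro j
    induction j with
    | zero => intro _; exact hY0
    | succ j ih =>
      intro hj
      have hjn : j < n := by omega
      have h1 := ih (by omega)
      have s := sexact _ _ (S.inj j) (S.exact j) (hp j hjn)
      have h2 := pd_add (S.mem j) hPQ
      exact s.hasProjectiveDimensionLT_X₁ _
        (hasProjectiveDimensionLT_of_ge (S.N j) (d + 1) _ (by omega))
        (hasProjectiveDimensionLT_of_ge (S.Y j) (n - j + 1) _ (by omega))
  refine ⟨C, S, hp, ?_, ?_⟩
  · refine claimR C S (n-d) d (by omega) _ (cc_of_ev k Q _ S.e0 (n-d) _ (finK d (by omega))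
      (idK d le_rfl) fun i hi => evK d (by omega) i hi (by omega)) _
  · have h3 := pdY (n-d) le_rfl
    rw [show n - (n-d) = d by omega] at h3
    refine claimR' C S hp d (n-d) (by omega) _ (dd_of_ev k Q _ C.e0 d _ (S.fin _)
      h3 fun i hi => evY (n-d) (by omega) i hi (by omega)) _

end Main1
end PaperAux
end
end Part5

section Part6
open MulOpposite
open Paper CategoryTheory Abelian

noncomputable section
namespace PaperAux
section Syz
variable {R : Type} [Ring R]

/-- `X` is in `add (X' ⊕ R)` -/
def Le (X X' : ModuleCat.{0} R) : Prop := Fac X' (ModuleCat.of R R) X X LinearMap.id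

/-- finitely generated projective -/
def FProj (P : ModuleCat.{0} R) : Prop :=
  Fac (ModuleCat.of R R) (ModuleCat.of R R) P P LinearMap.id

lemma Le.trans {X Y Z : ModuleCat.{0} R} (h : Le X Y) (h' : Le Y Z) : Le X Z :=
  Fac.trans h h' Fac.idR

lemma Le.of_equiv {X Y : ModuleCat.{0} R} (e : X ≃ₗ[R] Y) : Le X Y := by
  have : (LinearMap.id : X →ₗ[R] X) = e.symm.toLinearMap ∘ₗ e.toLinearMap := by
    ext x; simp
  unfold Le
  rw [this]; exact .viaL _ _

lemma FProj.le {P : ModuleCat.{0} R} (h : FProj P) (X : ModuleCat.{0} R) : Le P X :=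
  Fac.trans h Fac.idR Fac.idR

/-- not necessarily minimal syzygies -/
def GSyz : ℕ → ModuleCat.{0} R → ModuleCat.{0} R → Prop
  | 0, X, Z => Nonempty (Z ≃ₗ[R] X)
  | (n+1), X, Z => ∃ (Y P : ModuleCat.{0} R) (i : Y →ₗ[R] P) (p : P →ₗ[R] X),
      Function.Injective i ∧ Function.Exact i p ∧ Function.Surjective p ∧ FProj P ∧ GSyz n Y Z

lemma schanuel {X Y P X' Y' P' : ModuleCat.{0} R} (i : Y →ₗ[R] P) (p : P →ₗ[R] X)
    (i' : Y' →ₗ[R] P') (p' : P' →ₗ[R] X')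
    (hi : Function.Injective i) (hip : Function.Exact i p) (hp : Function.Surjective p)
    (hP : FProj P)
    (hi' : Function.Injective i') (hip' : Function.Exact i' p') (hp' : Function.Surjective p')
    (hP' : FProj P') (h : Le X X') : Le Y Y' := by
  have pP := proj_of_fac hP
  have pP' := proj_of_fac hP'
  have key : ∀ f : X →ₗ[R] X, Fac X' (ModuleCat.of R R) X X f →
      ∃ (F : P →ₗ[R] P) (φ : Y →ₗ[R] Y), p ∘ₗ F = f ∘ₗ p ∧ F ∘ₗ i = i ∘ₗ φ ∧
        Fac Y' (ModuleCat.of R R) Y Y φ := by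
    intro f hf
    induction hf with
    | viaL g h =>
      obtain ⟨G, hG⟩ := Module.projective_lifting_property p' (g ∘ₗ p) hp'
      obtain ⟨H, hH⟩ := Module.projective_lifting_property p (h ∘ₗ p') hp
      obtain ⟨γ, hγ⟩ := exists_cod hi' hip' (G ∘ₗ i) (by
        rw [← LinearMap.comp_assoc, hG, LinearMap.comp_assoc, hip.linearMap_comp_eq_zero,
          LinearMap.comp_zero])
      obtain ⟨η, hη⟩ := exists_cod hi hip (H ∘ₗ i') (by
        rw [← LinearMap.comp_assoc, hH, LinearMap.comp_assoc, hip'.linearMap_comp_eq_zero,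
          LinearMap.comp_zero])
      refine ⟨H ∘ₗ G, η ∘ₗ γ, ?_, ?_, .viaL _ _⟩
      · rw [← LinearMap.comp_assoc, hH, LinearMap.comp_assoc, hG, LinearMap.comp_assoc]
      · rw [LinearMap.comp_assoc, ← hγ, ← LinearMap.comp_assoc, ← hη, LinearMap.comp_assoc]
    | viaR g h =>
      obtain ⟨h', hh⟩ := Module.projective_lifting_property (P := R) p h hp
      refine ⟨h' ∘ₗ g ∘ₗ p, 0, ?_, ?_, Fac.zero⟩
      · rw [← LinearMap.comp_assoc, hh, LinearMap.comp_assoc]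
      · rw [LinearMap.comp_assoc, LinearMap.comp_assoc, hip.linearMap_comp_eq_zero]
        simp
    | add f g _ _ h1 h2 =>
      obtain ⟨F, φ, a, b, c⟩ := h1
      obtain ⟨F', φ', a', b', c'⟩ := h2
      refine ⟨F + F', φ + φ', ?_, ?_, .add _ _ c c'⟩
      · rw [LinearMap.comp_add, LinearMap.add_comp, a, a']
      · rw [LinearMap.comp_add, LinearMap.add_comp, b, b']
  obtain ⟨F, φ, a, b, c⟩ := key _ h
  obtain ⟨s, hs⟩ := exists_cod hi hip (LinearMap.id - F) (by
    rw [LinearMap.comp_sub, a]; simp)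
  have : (LinearMap.id : Y →ₗ[R] Y) = φ + s ∘ₗ i := by
    ext y
    apply hi
    have h1 := LinearMap.congr_fun hs (i y)
    have h2 := LinearMap.congr_fun b y
    simp only [LinearMap.comp_apply, LinearMap.sub_apply, LinearMap.id_apply] at h1 h2
    simp only [LinearMap.id_apply, LinearMap.add_apply, LinearMap.comp_apply, map_add, h1, ← h2]
    abel
  unfold Le
  rw [this]
  exact .add _ _ c (((hP.le Y').of_id_left s).comp_right i)

lemma GSyz.le (n : ℕ) : ∀ {X X' Z Z' : ModuleCat.{0} R}, GSyz n X Z → GSyz n X' Z' → Le X X' →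
    Le Z Z' := by
  induction n with
  | zero =>
    rintro X X' Z Z' ⟨e⟩ ⟨e'⟩ h
    exact ((Le.of_equiv e).trans h).trans (Le.of_equiv e'.symm)
  | succ n ih =>
    rintro X X' Z Z' ⟨Y, P, i, p, a1, a2, a3, a4, a5⟩ ⟨Y', P', i', p', b1, b2, b3, b4, b5⟩ h
    exact ih a5 b5 (schanuel i p i' p' a1 a2 a3 a4 b1 b2 b3 b4 h)

lemma finite_cover {P X : ModuleCat.{0} R} [Module.Finite R X] (p : P →ₗ[R] X)
    (h : IsProjCover R p) : Module.Finite R P := by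
  obtain ⟨_, hs, hk⟩ := h
  obtain ⟨s, hs'⟩ := (inferInstance : Module.Finite R X).fg_top
  classical
  choose g hg using hs
  refine ⟨⟨s.image g, hk _ ?_⟩⟩
  rw [eq_top_iff]
  intro x _
  have hx : p x ∈ Submodule.map p (Submodule.span R ↑(s.image g)) := by
    rw [Submodule.map_span]
    have : p '' ↑(s.image g) = (s : Set X) := by
      rw [Finset.coe_image, ← Set.image_comp]
      have : (p ∘ g) = id := funext hg
      rw [this, Set.image_id]
    rw [this, hs']; trivial
  obtain ⟨y, hy, hyx⟩ := hx
  have : x = y + (x - y) := by abel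
  rw [this]
  exact Submodule.add_mem_sup hy (by simp [hyx])

lemma gsyz_of_omega (k : Type) [Field k] [Algebra k R] [FiniteDimensional k R] (n : ℕ) :
    ∀ {X Z : ModuleCat.{0} R}, Module.Finite R X → IsOmegaOf R n X Z → GSyz n X Z := by
  induction n with
  | zero => intro X Z _ h; exact h
  | succ n ih =>
    rintro X Z _ ⟨Y, ⟨P, p, hc, ⟨e⟩⟩, h⟩
    have hf := finite_cover p hc
    have := noeth k P
    have hY : Module.Finite R Y := Module.Finite.equiv e.symm
    refine ⟨Y, P, (LinearMap.ker p).subtype ∘ₗ e.toLinearMap, p, ?_, ?_, hc.2.1,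
      fac_of_proj hc.1, ih hY h⟩
    · exact (Submodule.injective_subtype _).comp e.injective
    · rw [LinearMap.exact_iff, LinearMap.range_comp, LinearEquiv.range, Submodule.map_top,
        Submodule.range_subtype]

end Syz

section EndSide
variable (k : Type) [Field k] {A : Type} [Ring A] [Algebra k A] [FiniteDimensional k A]
  (Q : ModuleCat.{0} A)

instance fdEnd [Module.Finite A Q] : FiniteDimensional k (Module.End A Q) := by
  have := fd_of_finite k Q
  let res : (Q →ₗ[A] Q) →ₗ[k] (Q →ₗ[k] Q) :=
    { toFun := fun f => f.restrictScalars k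
      map_add' := fun _ _ => rfl
      map_smul' := fun _ _ => rfl }
  have hres : Function.Injective res := LinearMap.restrictScalars_injective k
  exact Module.Finite.of_injective res hres

include k in
lemma finQE [Module.Finite A Q] :
    Module.Finite (Module.End A Q) (ModuleCat.of (Module.End A Q) Q) := by
  have := fd_of_finite k Q
  exact Module.Finite.of_restrictScalars_finite k (Module.End A Q) Q

/-- `Hom_A(X,Q)` as a left `E`-module. -/
abbrev HQ (X : ModuleCat.{0} A) : ModuleCat.{0} (Module.End A Q) :=
  ModuleCat.of (Module.End A Q) (X →ₗ[A] Q)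

/-- functoriality -/
def hq {X Y : ModuleCat.{0} A} (f : X →ₗ[A] Y) : HQ Q Y →ₗ[Module.End A Q] HQ Q X where
  toFun (g : Y →ₗ[A] Q) := g ∘ₗ f
  map_add' _ _ := rfl
  map_smul' _ _ := rfl

variable {Q}

lemma Fac.hq {Y Q' X Z : ModuleCat.{0} A} {f : X →ₗ[A] Z} (h : Fac Y Q' X Z f) :
    Fac (HQ Q Y) (HQ Q Q') (HQ Q Z) (HQ Q X) (hq Q f) := by
  induction h with
  | viaL g h => exact .viaL (PaperAux.hq Q h) (PaperAux.hq Q g)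
  | viaR g h => exact .viaR (PaperAux.hq Q h) (PaperAux.hq Q g)
  | add f g _ _ h1 h2 =>
    have : PaperAux.hq Q (f + g) = PaperAux.hq Q f + PaperAux.hq Q g := by
      refine LinearMap.ext fun (a : _ →ₗ[A] Q) => ?_
      exact LinearMap.comp_add _ _ a
    rw [this]; exact .add _ _ h1 h2

lemma hq_le {X Y : ModuleCat.{0} A} (h : Fac Y Q X X LinearMap.id) : Le (HQ Q X) (HQ Q Y) := h.hq

lemma gsyz_coSeq {n : ℕ} (C : CoSeq Q n) (l : ℕ) : ∀ j, j + l ≤ n →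
    GSyz l (HQ Q (C.K j)) (HQ Q (C.K (j+l))) := by
  induction l with
  | zero => intro j _; exact ⟨LinearEquiv.refl _ _⟩
  | succ l ih =>
    intro j hj
    refine ⟨HQ Q (C.K (j+1)), HQ Q (C.M j), hq Q (C.π j), hq Q (C.ι j), ?_, ?_, ?_, ?_, ?_⟩
    · intro f g h
      exact (LinearMap.cancel_right (C.surj j (by omega))).1 h
    · intro f
      constructor
      · intro h
        obtain ⟨v, hv⟩ := exists_desc (C.exact j (by omega)) (C.surj j (by omega)) f h
        exact ⟨v, hv⟩
      · rintro ⟨g, rfl⟩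
        refine LinearMap.ext fun x => ?_
        show g (C.π j (C.ι j x)) = 0
        rw [(C.exact j (by omega)).apply_apply_eq_zero, map_zero]
    · exact C.ext j (by omega)
    · exact (fac_of_inAdd (C.mem j (by omega))).hq
    · have := ih (j+1) (by omega)
      rwa [show j + (l+1) = j + 1 + l by omega]

/-- evaluation at one -/
def homAQ (K : ModuleCat.{0} A) (e : A ≃ₗ[A] K) :
    HQ Q K ≃ₗ[Module.End A Q] ModuleCat.of (Module.End A Q) Q where
  toFun (f : K →ₗ[A] Q) := f (e 1)
  invFun q := (LinearMap.toSpanSingleton A Q q) ∘ₗ e.symm.toLinearMap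
  map_add' _ _ := rfl
  map_smul' _ _ := rfl
  left_inv (f : K →ₗ[A] Q) := LinearMap.ext fun x => by
    show (e.symm x) • f (e 1) = f x
    rw [← map_smul, ← map_smul, smul_eq_mul, mul_one, e.apply_symm_apply]
  right_inv q := by
    show (e.symm (e 1)) • q = q
    rw [e.symm_apply_apply, one_smul]

include k in
/-- the syzygy side -/
lemma zside [Module.Finite A Q] {n d : ℕ} (C : CoSeq Q n) (hd : d ≤ n)
    (Z : ModuleCat.{0} (Module.End A Q))
    (hZ : IsOmegaOf (Module.End A Q) d (ModuleCat.of (Module.End A Q) Q) Z) :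
    Le Z (HQ Q (C.K d)) ∧ Le (HQ Q (C.K d)) Z := by
  have h1 := gsyz_of_omega k d (finQE k Q) hZ
  have h2 := gsyz_coSeq C d 0 (by omega)
  rw [zero_add] at h2
  have e := homAQ (Q := Q) (C.K 0) C.e0
  exact ⟨GSyz.le d h1 h2 (Le.of_equiv e.symm), GSyz.le d h2 h1 (Le.of_equiv e)⟩

end EndSide
end PaperAux
end
end Part6

section Part7
open MulOpposite
open Paper CategoryTheory Abelian

noncomputable section
namespace PaperAux
section DualSyz
variable (k : Type) [Field k] {R S : Type} [Ring R] [Algebra k R] [Ring S]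
  (σ : S ≃+* Rᵐᵒᵖ)

/-- dual of an isomorphism -/
def dequiv {X Y : ModuleCat.{0} R} (e : X ≃ₗ[R] Y) : DM k σ X ≃ₗ[S] DM k σ Y :=
  LinearEquiv.ofLinear (dmap k σ e.symm.toLinearMap) (dmap k σ e.toLinearMap)
    (by rw [← dmap_comp]
        have : e.toLinearMap ∘ₗ e.symm.toLinearMap = LinearMap.id := by ext x; simp
        rw [this, dmap_id])
    (by rw [← dmap_comp]
        have : e.symm.toLinearMap ∘ₗ e.toLinearMap = LinearMap.id := by ext x; simp
        rw [this, dmap_id])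

variable [FiniteDimensional k R]

lemma fproj_dual {X : ModuleCat.{0} R} (h : Fac (DB k R) (DB k R) X X LinearMap.id) :
    FProj (DM k σ X) :=
  (dmap_id (k := k) (σ := σ) (X := X) ▸ h.dmap).trans (fac_ddual k σ _) (fac_ddual k σ _)

lemma gsyz_dual (m : ℕ) : ∀ {X W : ModuleCat.{0} R}, Module.Finite R X →
    IsOmegaInvOf R m X W → GSyz m (DM k σ X) (DM k σ W) := by
  induction m with
  | zero => rintro X W _ ⟨e⟩; exact ⟨dequiv k σ e⟩
  | succ m ih =>
    rintro X W _ ⟨Y, ⟨I, ι, ⟨hI, hι, hess⟩, ⟨e⟩⟩, h⟩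
    obtain ⟨r, i, hi⟩ := embed k X
    obtain ⟨g, hg⟩ := (inj_pow (inj_D k R) r).out ι hι i
    have hgk : LinearMap.ker g = ⊥ := by
      apply hess
      rw [eq_bot_iff]
      rintro _ ⟨hx, ⟨x, rfl⟩⟩
      have h1 : i x = i 0 := (hg x).symm.trans (hx.trans (map_zero i).symm)
      rw [hi h1, map_zero]; exact Submodule.zero_mem _
    have hgi : Function.Injective g := LinearMap.ker_eq_bot.1 hgk
    have hfp : Module.Finite R (ModuleCat.of R (Fin r → DB k R)) :=
      inferInstanceAs (Module.Finite R (Fin r → DBt k R))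
    have := noeth k (ModuleCat.of R (Fin r → DB k R))
    have hIf : Module.Finite R I := Module.Finite.of_injective g hgi
    have hY : Module.Finite R Y := Module.Finite.equiv e.symm
    let π : I →ₗ[R] Y := e.symm.toLinearMap ∘ₗ (LinearMap.range ι).mkQ
    have hπ : Function.Surjective π := e.symm.surjective.comp (Submodule.mkQ_surjective _)
    have hE : Function.Exact ι π := by
      rw [LinearMap.exact_iff, LinearMap.ker_comp, LinearEquiv.ker, ← LinearMap.ker,
        Submodule.ker_mkQ]
    exact ⟨DM k σ Y, DM k σ I, dmap k σ π, dmap k σ ι, dmap_inj _ hπ, dmap_exact _ _ hE hπ,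
      dmap_surj _ hι, fproj_dual k σ (fac_of_injective hI g hgi), ih hY h⟩

end DualSyz

section EndSide2
variable {A : Type} [Ring A] (Q : ModuleCat.{0} A)

/-- `Hom_A(Q,X)` as a left `Eᵐᵒᵖ`-module. -/
abbrev HP (X : ModuleCat.{0} A) : ModuleCat.{0} (Module.End A Q)ᵐᵒᵖ :=
  @ModuleCat.of (Module.End A Q)ᵐᵒᵖ _ (Q →ₗ[A] X) _ (homPrecompMod A Q X)

/-- functoriality -/
def hp {X Y : ModuleCat.{0} A} (f : X →ₗ[A] Y) : HP Q X →ₗ[(Module.End A Q)ᵐᵒᵖ] HP Q Y where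
  toFun (g : Q →ₗ[A] X) := f ∘ₗ g
  map_add' (a b : Q →ₗ[A] X) := LinearMap.comp_add a b f
  map_smul' _ _ := rfl

variable {Q}

lemma Fac.hp {Y Q' X Z : ModuleCat.{0} A} {f : X →ₗ[A] Z} (h : Fac Y Q' X Z f) :
    Fac (HP Q Y) (HP Q Q') (HP Q X) (HP Q Z) (hp Q f) := by
  induction h with
  | viaL g h => exact .viaL (PaperAux.hp Q g) (PaperAux.hp Q h)
  | viaR g h => exact .viaR (PaperAux.hp Q g) (PaperAux.hp Q h)
  | add f g _ _ h1 h2 =>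
    have : PaperAux.hp Q (f + g) = PaperAux.hp Q f + PaperAux.hp Q g := rfl
    rw [this]; exact .add _ _ h1 h2

variable (Q) in
/-- `Hom_A(Q,Q)` is regular -/
def hpQ : HP Q Q ≃ₗ[(Module.End A Q)ᵐᵒᵖ]
    ModuleCat.of (Module.End A Q)ᵐᵒᵖ (Module.End A Q)ᵐᵒᵖ where
  toFun (f : Module.End A Q) := op f
  invFun (f : (Module.End A Q)ᵐᵒᵖ) := f.unop
  map_add' _ _ := rfl
  map_smul' _ _ := rfl
  left_inv _ := rfl
  right_inv _ := rfl

lemma fproj_hp {N : ModuleCat.{0} A} (h : InAdd A Q N) : FProj (HP Q N) := by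
  have h1 : Fac (HP Q Q) (HP Q Q) (HP Q N) (HP Q N) LinearMap.id := (fac_of_inAdd h).hp
  have h2 := Le.of_equiv (hpQ Q)
  exact h1.trans h2 h2

lemma gsyz_resSeq {D : ModuleCat.{0} A} (S : ResSeq Q D) (l : ℕ) : ∀ j,
    GSyz l (HP Q (S.Y j)) (HP Q (S.Y (j+l))) := by
  induction l with
  | zero => intro j; exact ⟨LinearEquiv.refl _ _⟩
  | succ l ih =>
    intro j
    refine ⟨HP Q (S.Y (j+1)), HP Q (S.N j), hp Q (S.ι j), hp Q (S.p j), ?_, ?_, ?_, ?_, ?_⟩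
    · intro f g h
      exact (LinearMap.cancel_left (S.inj j)).1 h
    · intro f
      constructor
      · intro h
        obtain ⟨v, hv⟩ := exists_cod (S.inj j) (S.exact j) f h
        exact ⟨v, hv⟩
      · rintro ⟨(g : Q →ₗ[A] _), rfl⟩
        refine LinearMap.ext fun x => ?_
        exact (S.exact j).apply_apply_eq_zero (g x)
    · exact S.lift j
    · exact fproj_hp (S.mem j)
    · have := ih (j+1)
      rwa [show j + (l+1) = j + 1 + l by omega]

section kk
variable (k : Type) [Field k] [Algebra k A]
/-- `Hom_A(Q, DA) = DQ` -/
def hpD (K : ModuleCat.{0} A) (e : DB k A ≃ₗ[A] K) :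
    HP Q K ≃ₗ[(Module.End A Q)ᵐᵒᵖ]
      DM k (RingEquiv.refl (Module.End A Q)ᵐᵒᵖ) (ModuleCat.of (Module.End A Q) Q) where
  toFun (f : Q →ₗ[A] K) := show Q →ₗ[k] k from fromD (e.symm.toLinearMap ∘ₗ f)
  invFun (φ : Q →ₗ[k] k) := e.toLinearMap ∘ₗ toD φ
  map_add' (f g : Q →ₗ[A] K) := LinearMap.ext fun q => by
    show DBt.ev (e.symm (f q + g q)) 1 = DBt.ev (e.symm (f q)) 1 + DBt.ev (e.symm (g q)) 1
    rw [map_add]; rfl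
  map_smul' _ _ := rfl
  left_inv (f : Q →ₗ[A] K) := by
    show e.toLinearMap ∘ₗ toD (fromD (e.symm.toLinearMap ∘ₗ f)) = f
    rw [toD_fromD]; ext x; simp
  right_inv (φ : Q →ₗ[k] k) := by
    show fromD (e.symm.toLinearMap ∘ₗ (e.toLinearMap ∘ₗ toD φ)) = φ
    have : e.symm.toLinearMap ∘ₗ (e.toLinearMap ∘ₗ toD φ) = toD φ :=
      LinearMap.ext fun x => e.symm_apply_apply _
    rw [this, fromD_toD]

/-- `Dop` and `DM` agree -/
def dopEquiv {B : Type} [Ring B] [Algebra k B] (X : ModuleCat.{0} B) :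
    Dop k B X ≃ₗ[Bᵐᵒᵖ] DM k (RingEquiv.refl Bᵐᵒᵖ) X where
  toFun (f : X →ₗ[k] k) := f
  invFun (f : X →ₗ[k] k) := f
  map_add' _ _ := rfl
  map_smul' _ _ := rfl
  left_inv _ := rfl
  right_inv _ := rfl

variable [FiniteDimensional k A] [Module.Finite A Q]

lemma wside (S : ResSeq Q (DB k A)) (m : ℕ) (W : ModuleCat.{0} (Module.End A Q))
    (hW : IsOmegaInvOf (Module.End A Q) m (ModuleCat.of (Module.End A Q) Q) W) :
    Le (Dop k (Module.End A Q) W) (HP Q (S.Y m)) ∧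
    Le (HP Q (S.Y m)) (Dop k (Module.End A Q) W) := by
  have h1 := gsyz_dual k (RingEquiv.refl (Module.End A Q)ᵐᵒᵖ) m (finQE k Q) hW
  have h2 := gsyz_resSeq S m 0
  rw [zero_add] at h2
  have e := hpD (Q := Q) k (S.Y 0) S.e0
  exact ⟨(Le.of_equiv (dopEquiv k W)).trans (GSyz.le m h1 h2 (Le.of_equiv e.symm)),
    (GSyz.le m h2 h1 (Le.of_equiv e)).trans (Le.of_equiv (dopEquiv k W).symm)⟩
end kk
end EndSide2

section TFun
variable {B : Type} [Ring B]

/-- `Hom(−, Bᵐᵒᵖ)` -/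
abbrev TT (G : ModuleCat.{0} Bᵐᵒᵖ) : ModuleCat.{0} B :=
  (ModuleCat.restrictScalars (opOpHom B)).obj (ModuleCat.of Bᵐᵒᵖᵐᵒᵖ (G →ₗ[Bᵐᵒᵖ] Bᵐᵒᵖ))

/-- functoriality -/
def tmap {G H : ModuleCat.{0} Bᵐᵒᵖ} (f : G →ₗ[Bᵐᵒᵖ] H) : TT H →ₗ[B] TT G where
  toFun (g : H →ₗ[Bᵐᵒᵖ] Bᵐᵒᵖ) := show G →ₗ[Bᵐᵒᵖ] Bᵐᵒᵖ from g ∘ₗ f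
  map_add' _ _ := rfl
  map_smul' _ _ := rfl

lemma Fac.tmap {Y Q' X Z : ModuleCat.{0} Bᵐᵒᵖ} {f : X →ₗ[Bᵐᵒᵖ] Z} (h : Fac Y Q' X Z f) :
    Fac (TT Y) (TT Q') (TT Z) (TT X) (tmap f) := by
  induction h with
  | viaL g h => exact .viaL (PaperAux.tmap h) (PaperAux.tmap g)
  | viaR g h => exact .viaR (PaperAux.tmap h) (PaperAux.tmap g)
  | add f g _ _ h1 h2 =>
    have : PaperAux.tmap (f + g) = PaperAux.tmap f + PaperAux.tmap g := by
      refine LinearMap.ext fun (a : _ →ₗ[Bᵐᵒᵖ] Bᵐᵒᵖ) => ?_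
      exact LinearMap.comp_add _ _ a
    rw [this]; exact .add _ _ h1 h2

variable (B) in
/-- dual of regular is regular -/
def tReg : TT (ModuleCat.of Bᵐᵒᵖ Bᵐᵒᵖ) ≃ₗ[B] ModuleCat.of B B where
  toFun (f : Bᵐᵒᵖ →ₗ[Bᵐᵒᵖ] Bᵐᵒᵖ) := (f 1).unop
  invFun b := LinearMap.toSpanSingleton Bᵐᵒᵖ Bᵐᵒᵖ (op b)
  map_add' _ _ := rfl
  map_smul' _ _ := rfl
  left_inv (f : Bᵐᵒᵖ →ₗ[Bᵐᵒᵖ] Bᵐᵒᵖ) := LinearMap.ext fun x => by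
    show x • op (f 1).unop = f x
    rw [op_unop, ← map_smul, smul_eq_mul, mul_one]
  right_inv b := by
    exact congrArg unop (one_smul Bᵐᵒᵖ (op b))

lemma Le.tt {X Y : ModuleCat.{0} Bᵐᵒᵖ} (h : Le X Y) : Le (TT X) (TT Y) := by
  have h1 : Fac (TT Y) (TT (ModuleCat.of Bᵐᵒᵖ Bᵐᵒᵖ)) (TT X) (TT X) LinearMap.id := Fac.tmap h
  refine h1.trans Fac.idL ?_
  have h2 : FProj (TT (ModuleCat.of Bᵐᵒᵖ Bᵐᵒᵖ)) := Le.of_equiv (tReg B)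
  exact h2.le _

end TFun

section Dbl
variable {A : Type} [Ring A] {Q : ModuleCat.{0} A}

/-- biduality map -/
def psi (Y : ModuleCat.{0} A) : HQ Q Y →ₗ[Module.End A Q] TT (HP Q Y) where
  toFun (f : Y →ₗ[A] Q) := show HP Q Y →ₗ[(Module.End A Q)ᵐᵒᵖ] (Module.End A Q)ᵐᵒᵖ from
    { toFun := fun (g : Q →ₗ[A] Y) => op (show Module.End A Q from f ∘ₗ g)
      map_add' := fun (a b : Q →ₗ[A] Y) =>
        congrArg op (LinearMap.comp_add a b f : _ = (f ∘ₗ a + f ∘ₗ b : Module.End A Q))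
      map_smul' := fun _ _ => rfl }
  map_add' _ _ := rfl
  map_smul' _ _ := rfl

lemma comp_zero_of_gen {N X : ModuleCat.{0} A} (h : InAdd A Q N) (u : N →ₗ[A] X)
    (hu : ∀ g : Q →ₗ[A] N, u ∘ₗ g = 0) : u = 0 := by
  have key : ∀ φ : N →ₗ[A] N, Fac Q Q N N φ → u ∘ₗ φ = 0 := by
    intro φ hφ
    induction hφ with
    | viaL g h => rw [← LinearMap.comp_assoc, hu, LinearMap.zero_comp]
    | viaR g h => rw [← LinearMap.comp_assoc, hu, LinearMap.zero_comp]
    | add f g _ _ h1 h2 => rw [LinearMap.comp_add, h1, h2, add_zero]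
  simpa using key _ (fac_of_inAdd h)

lemma repr_of_gen {N : ModuleCat.{0} A} (h : InAdd A Q N)
    (θ : HP Q N →ₗ[(Module.End A Q)ᵐᵒᵖ] (Module.End A Q)ᵐᵒᵖ) :
    ∃ u : N →ₗ[A] Q, ∀ g : Q →ₗ[A] N, θ g = op (u ∘ₗ g : Module.End A Q) := by
  have key : ∀ φ : N →ₗ[A] N, Fac Q Q N N φ →
      ∃ u : N →ₗ[A] Q, ∀ g : Q →ₗ[A] N, θ (φ ∘ₗ g : Q →ₗ[A] N) = op (u ∘ₗ g : Module.End A Q) := by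
    have via : ∀ (g0 : N →ₗ[A] Q) (h0 : Q →ₗ[A] N), ∃ u : N →ₗ[A] Q, ∀ g : Q →ₗ[A] N,
        θ ((h0 ∘ₗ g0) ∘ₗ g : Q →ₗ[A] N) = op (u ∘ₗ g : Module.End A Q) := by
      intro g0 h0
      refine ⟨(θ h0).unop ∘ₗ g0, fun g => ?_⟩
      exact θ.map_smul (op (g0 ∘ₗ g : Module.End A Q)) h0
    intro φ hφ
    induction hφ with
    | viaL g h => exact via g h
    | viaR g h => exact via g h
    | add f g _ _ h1 h2 =>
      obtain ⟨u, hu⟩ := h1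
      obtain ⟨v, hv⟩ := h2
      refine ⟨u + v, fun a => ?_⟩
      exact (θ.map_add (f ∘ₗ a : Q →ₗ[A] N) (g ∘ₗ a : Q →ₗ[A] N)).trans
        (congrArg₂ (· + ·) (hu a) (hv a))
  obtain ⟨u, hu⟩ := key _ (fac_of_inAdd h)
  exact ⟨u, hu⟩

lemma psi_bij {D : ModuleCat.{0} A} (S : ResSeq Q D) (m : ℕ) (h1 : Function.Surjective (S.p m))
    (h2 : Function.Surjective (S.p (m+1))) : Function.Bijective (psi (Q := Q) (S.Y m)) := by
  constructor
  · intro (f : S.Y m →ₗ[A] Q) (f' : S.Y m →ₗ[A] Q) h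
    have h3 : ∀ g : Q →ₗ[A] S.Y m, f ∘ₗ g = f' ∘ₗ g := fun g =>
      op_injective (LinearMap.congr_fun
        (show (psi (Q := Q) (S.Y m) f : HP Q (S.Y m) →ₗ[_] (Module.End A Q)ᵐᵒᵖ) = _ from h) g)
    have h4 : (f - f') ∘ₗ S.p m = 0 := comp_zero_of_gen (S.mem m) _ fun g => by
      rw [LinearMap.comp_assoc, LinearMap.sub_comp, h3, sub_self]
    have h5 : f - f' = 0 := by
      rw [← LinearMap.cancel_right h1, h4, LinearMap.zero_comp]
    exact sub_eq_zero.1 h5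
  · intro (θ : HP Q (S.Y m) →ₗ[(Module.End A Q)ᵐᵒᵖ] (Module.End A Q)ᵐᵒᵖ)
    obtain ⟨u, hu⟩ := repr_of_gen (S.mem m) (θ ∘ₗ hp Q (S.p m))
    have hu0 : u ∘ₗ S.ι m = 0 := by
      rw [← LinearMap.cancel_right h2, LinearMap.zero_comp]
      refine comp_zero_of_gen (S.mem (m+1)) _ fun g => ?_
      apply op_injective (α := Module.End A Q)
      refine (hu (S.ι m ∘ₗ S.p (m+1) ∘ₗ g)).symm.trans ?_
      have : hp Q (S.p m) (S.ι m ∘ₗ S.p (m+1) ∘ₗ g : Q →ₗ[A] S.N m) = 0 :=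
        LinearMap.ext fun x => (S.exact m).apply_apply_eq_zero _
      exact (congrArg θ this).trans (map_zero θ)
    obtain ⟨v, hv⟩ := exists_desc (S.exact m) h1 u hu0
    refine ⟨v, ?_⟩
    refine LinearMap.ext (σ := RingHom.id (Module.End A Q)ᵐᵒᵖ) (M := HP Q (S.Y m))
      (M₃ := (Module.End A Q)ᵐᵒᵖ) fun (g : Q →ₗ[A] S.Y m) => ?_
    obtain ⟨h, rfl⟩ := S.lift m g
    refine Eq.trans ?_ (hu h).symm
    show op (v ∘ₗ (S.p m ∘ₗ h) : Module.End A Q) = _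
    rw [← LinearMap.comp_assoc, hv]

end Dbl

theorem final (k : Type) [Field k] (A : Type) [Ring A] [Algebra k A] [FiniteDimensional k A]
    (Q : ModuleCat.{0} A) [Module.Finite A Q] (n d : ℕ)
    (hpair : IsRelAGPair A Q n) (hpd : pdLE A Q d) (hid : idLE A Q (n - d))
    (hdn : d ≤ n - 1) (hd2 : 2 ≤ d) (Z W : ModuleCat.{0} (Module.End A Q))
    (hZ : IsOmegaOf (Module.End A Q) d (ModuleCat.of (Module.End A Q) Q) Z)
    (hW : IsOmegaInvOf (Module.End A Q) (n - d) (ModuleCat.of (Module.End A Q) Q) W) :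
    Le Z (nuInv k (Module.End A Q) W) ∧ Le (nuInv k (Module.End A Q) W) Z := by
  obtain ⟨C, S, hp, h1, h2⟩ := main1 k Q n d hpair hpd hid hdn hd2
  obtain ⟨z1, z2⟩ := zside k C (by omega) Z hZ
  obtain ⟨w1, w2⟩ := wside k S (n-d) W hW
  let e := LinearEquiv.ofBijective _ (psi_bij S (n-d) (hp _ (by omega)) (hp _ (by omega)))
  exact ⟨((z1.trans (hq_le h1)).trans (Le.of_equiv e)).trans w2.tt,
    ((w1.tt.trans (Le.of_equiv e.symm)).trans (hq_le h2)).trans z2⟩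

end PaperAux
end
end Part7

noncomputable section Statement9
open Paper

/-- Lemma 3.5(i): for a relative `n`-Auslander–Gorenstein pair `(A, Q)`
with `pd_A Q ≤ d`, `id_A Q ≤ n − d`, `1 ≤ d ≤ n − 1` and `d ≥ 2`, one has
`add(Ω^d(Q) ⊕ Λ) = add(ν⁻_Λ Ω^{−(n−d)}(Q) ⊕ Λ)` as subcategories of right
`Λ`-modules (`Λ = End_A(Q)^op`; right `Λ`-modules are left `End_A(Q)`-modules, and
the regular right `Λ`-module is `End_A(Q)` itself). -/
theorem stmt9 (k : Type) [Field k] (A : Type) [Ring A] [Algebra k A] [FiniteDimensional k A]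
    (Q : ModuleCat.{0} A) [Module.Finite A Q] (n d : ℕ)
    (hpair : IsRelAGPair A Q n) (hpd : pdLE A Q d) (hid : idLE A Q (n - d))
    (hd1 : 1 ≤ d) (hdn : d ≤ n - 1) (hd2 : 2 ≤ d) :
    ∀ Z W : ModuleCat.{0} (Module.End A Q),
      IsOmegaOf (Module.End A Q) d (ModuleCat.of (Module.End A Q) Q) Z →
      IsOmegaInvOf (Module.End A Q) (n - d) (ModuleCat.of (Module.End A Q) Q) W →
      ∀ X : ModuleCat.{0} (Module.End A Q),
        (InAdd (Module.End A Q)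
            (ModuleCat.of (Module.End A Q) (Z × (Module.End A Q))) X ↔
         InAdd (Module.End A Q)
            (ModuleCat.of (Module.End A Q)
              ((nuInv k (Module.End A Q) W) × (Module.End A Q))) X) := by
  intro Z W hZ hW X
  obtain ⟨h1, h2⟩ := PaperAux.final k A Q n d hpair hpd hid hdn hd2 Z W hZ hW
  constructor
  · intro h
    exact PaperAux.inAdd_of_fac (Q := ModuleCat.of (Module.End A Q) (Module.End A Q))
      (PaperAux.Fac.trans (PaperAux.fac_of_inAdd_prod
        (Q := ModuleCat.of (Module.End A Q) (Module.End A Q)) h) h1 PaperAux.Fac.idR)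
  · intro h
    exact PaperAux.inAdd_of_fac (Q := ModuleCat.of (Module.End A Q) (Module.End A Q))
      (PaperAux.Fac.trans (PaperAux.fac_of_inAdd_prod
        (Q := ModuleCat.of (Module.End A Q) (Module.End A Q)) h) h2 PaperAux.Fac.idR)

end Statement9
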